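/- arXiv:1101.5830 — 2 statements merged into one kernel-verified Lean document; each statement's English description precedes it below -/
import Mathlib

section
/- There exists α₀ > 0 such that for every α ∈ (0, α₀) there exists η₀ > 0 such that for every η ∈ (0, η₀) there exists n₀ with the following property. Let H be a 3-graph on n ≥ n₀ vertices with δ₁(H) ≥ (5/9 − 10η)·C(n,2), let t = ⌊η·√(log₂(η²·n))⌋, let T be a tripartite cover of H all of whose members have class size exactly t with |V(T)| ≥ n/2, and let I = V ∖ V(T) satisfy |I| ≥ η²·n and e(H|_I) < η·C(|I|,3). Suppose at most η·|V(T)| vertices lie in members of T that are at least 2-sided (with respect to I and η), and for at least (1 − 2√η)·C(|T|,2) unordered pairs {T_i, T_j} of distinct members of T the link graph L_ij is isomorphic to B₃₁₁. Then either H admits a tripartite cover T′ all of whose members have the same class size with |V(T′)| ≥ |V(T)| + η⁴·n, or H is α-extremal. -/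
attribute [local instance] Classical.propDecidable

/-- The vertex set of a (candidate) complete 3-partite subgraph. -/
def triVerts {V : Type} [DecidableEq V] (p : Finset V × Finset V × Finset V) : Finset V :=
  p.1 ∪ p.2.1 ∪ p.2.2

/-- `p` is a complete 3-partite subgraph of the 3-graph `H`. -/
def IsCompleteTri {V : Type} [DecidableEq V] (H : Finset (Finset V))
    (p : Finset V × Finset V × Finset V) : Prop :=
  Disjoint p.1 p.2.1 ∧ Disjoint p.1 p.2.2 ∧ Disjoint p.2.1 p.2.2 ∧
    ∀ x ∈ p.1, ∀ y ∈ p.2.1, ∀ z ∈ p.2.2, ({x, y, z} : Finset V) ∈ H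

/-- `T` is a tripartite cover of `H`: a family of complete 3-partite subgraphs of `H`
with pairwise disjoint vertex sets. -/
def IsTriCover {V : Type} [DecidableEq V] (H : Finset (Finset V))
    (T : Finset (Finset V × Finset V × Finset V)) : Prop :=
  (∀ p ∈ T, IsCompleteTri H p) ∧
    (T : Set (Finset V × Finset V × Finset V)).Pairwise
      fun p q => Disjoint (triVerts p) (triVerts q)

/-- The set of vertices covered by a tripartite cover. -/
def coverVerts {V : Type} [DecidableEq V] (T : Finset (Finset V × Finset V × Finset V)) :
    Finset V :=
  T.biUnion triVerts

/-- The class `W` is heavy (with respect to `I` and `η`): the number of edges of `H` with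
one vertex in `W` and two vertices in `I` is at least `2η·|W|·C(|I|,2)`. -/
def Heavy {V : Type} [DecidableEq V] (H : Finset (Finset V)) (I : Finset V) (η : ℝ)
    (W : Finset V) : Prop :=
  2 * η * W.card * (I.card.choose 2 : ℝ) ≤
    ((H.filter fun e => (e ∩ W).card = 1 ∧ (e ∩ I).card = 2).card : ℝ)

/-- A member of a cover is at least 2-sided if at least two of its classes are heavy. -/
def TwoSided {V : Type} [DecidableEq V] (H : Finset (Finset V)) (I : Finset V) (η : ℝ)
    (p : Finset V × Finset V × Finset V) : Prop :=
  (Heavy H I η p.1 ∧ Heavy H I η p.2.1) ∨ (Heavy H I η p.1 ∧ Heavy H I η p.2.2) ∨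
    (Heavy H I η p.2.1 ∧ Heavy H I η p.2.2)

/-- The classes of a member, indexed by `Fin 3`. -/
def cls {V : Type} (p : Finset V × Finset V × Finset V) : Fin 3 → Finset V :=
  ![p.1, p.2.1, p.2.2]

/-- `I` is connected to the pair of classes `(P, Q)`: the number of edges `{x,a,b}` of
`H` with `x ∈ I`, `a ∈ P`, `b ∈ Q` is at least `2η·|I|·|P|·|Q|`. -/
def ConnTo {V : Type} [DecidableEq V] (H : Finset (Finset V)) (I : Finset V) (η : ℝ)
    (P Q : Finset V) : Prop :=
  2 * η * I.card * P.card * Q.card ≤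
    (((I ×ˢ P ×ˢ Q).filter fun w => ({w.1, w.2.1, w.2.2} : Finset V) ∈ H).card : ℝ)

/-- The link graph `L_ij` of the pair `(p, q)` is isomorphic to `B₃₁₁`: under some
relabelling of the two parts its edge set is exactly
`{(1,1), (1,2), (1,3), (2,1), (3,1)}`. -/
def LinkB311 {V : Type} [DecidableEq V] (H : Finset (Finset V)) (I : Finset V) (η : ℝ)
    (p q : Finset V × Finset V × Finset V) : Prop :=
  ∃ f g : Fin 3 ≃ Fin 3, ∀ a b : Fin 3,
    ConnTo H I η (cls p a) (cls q b) ↔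
      (a, b) ∈ ({(f 0, g 0), (f 0, g 1), (f 0, g 2), (f 1, g 0), (f 2, g 0)} :
        Finset (Fin 3 × Fin 3))

section Counting

variable {V : Type} [DecidableEq V]

/-- The number of ordered triples in `X × Y × Z` that span an edge of `H`. -/
noncomputable def edgeSum (H : Finset (Finset V)) (X Y Z : Finset V) : ℝ :=
  ∑ x ∈ X, ∑ y ∈ Y, ∑ z ∈ Z, if ({x, y, z} : Finset V) ∈ H then 1 else 0

lemma card_filter_edge_eq_edgeSum (H : Finset (Finset V)) (X Y Z : Finset V) :
    (((X ×ˢ Y ×ˢ Z).filter fun w => ({w.1, w.2.1, w.2.2} : Finset V) ∈ H).card : ℝ) =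
      edgeSum H X Y Z := by
  rw [Finset.card_filter, edgeSum]
  push_cast
  rw [Finset.sum_product]
  refine Finset.sum_congr rfl fun x _ => ?_
  rw [Finset.sum_product]

lemma edgeSum_nonneg (H : Finset (Finset V)) (X Y Z : Finset V) : 0 ≤ edgeSum H X Y Z :=
  Finset.sum_nonneg fun _ _ => Finset.sum_nonneg fun _ _ => Finset.sum_nonneg fun _ _ => by
    split_ifs <;> norm_num

lemma edgeSum_le (H : Finset (Finset V)) (X Y Z : Finset V) :
    edgeSum H X Y Z ≤ X.card * Y.card * Z.card := by
  rw [← card_filter_edge_eq_edgeSum]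
  refine (Nat.cast_le.2 (Finset.card_filter_le _ _)).trans ?_
  simp [Finset.card_product, mul_assoc]

lemma edgeSum_swap_right (H : Finset (Finset V)) (X Y Z : Finset V) :
    edgeSum H X Y Z = edgeSum H X Z Y := by
  unfold edgeSum
  refine Finset.sum_congr rfl fun x _ => ?_
  rw [Finset.sum_comm]
  refine Finset.sum_congr rfl fun z _ => Finset.sum_congr rfl fun y _ => ?_
  rw [show ({x, y, z} : Finset V) = {x, z, y} by ext; simp; tauto]

lemma edgeSum_swap_left (H : Finset (Finset V)) (X Y Z : Finset V) :
    edgeSum H X Y Z = edgeSum H Y X Z := by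
  unfold edgeSum
  rw [Finset.sum_comm]
  refine Finset.sum_congr rfl fun y _ => Finset.sum_congr rfl fun x _ =>
    Finset.sum_congr rfl fun z _ => ?_
  rw [show ({x, y, z} : Finset V) = {y, x, z} by ext; simp; tauto]

lemma edgeSum_union_left_le (H : Finset (Finset V)) (X X' Y Z : Finset V) :
    edgeSum H (X ∪ X') Y Z ≤ edgeSum H X Y Z + edgeSum H X' Y Z := by
  have := Finset.sum_union_inter (s₁ := X) (s₂ := X') (f := fun x =>
    ∑ y ∈ Y, ∑ z ∈ Z, if ({x, y, z} : Finset V) ∈ H then (1 : ℝ) else 0)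
  have h0 := edgeSum_nonneg H (X ∩ X') Y Z
  unfold edgeSum at *
  linarith

lemma edgeSum_biUnion_left_le {ι : Type*} (H : Finset (Finset V)) (s : Finset ι)
    (X : ι → Finset V) (Y Z : Finset V) :
    edgeSum H (s.biUnion X) Y Z ≤ ∑ i ∈ s, edgeSum H (X i) Y Z := by
  induction s using Finset.induction_on with
  | empty => simp [edgeSum]
  | insert i s hi ih =>
    rw [Finset.biUnion_insert, Finset.sum_insert hi]
    exact (edgeSum_union_left_le _ _ _ _ _).trans (by linarith)

lemma edgeSum_mono {H : Finset (Finset V)} {X X' Y Y' Z Z' : Finset V}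
    (hX : X ⊆ X') (hY : Y ⊆ Y') (hZ : Z ⊆ Z') : edgeSum H X Y Z ≤ edgeSum H X' Y' Z' := by
  rw [← card_filter_edge_eq_edgeSum, ← card_filter_edge_eq_edgeSum]
  exact Nat.cast_le.2 (Finset.card_le_card (Finset.filter_subset_filter _
    (Finset.product_subset_product hX (Finset.product_subset_product hY hZ))))

/-- Each edge spans at most `27` ordered triples of its vertices. -/
lemma edgeSum_le_of_forall_mem {H K : Finset (Finset V)} (hK : ∀ e ∈ K, e.card = 3)
    {X Y Z : Finset V}
    (h : ∀ x ∈ X, ∀ y ∈ Y, ∀ z ∈ Z, ({x, y, z} : Finset V) ∈ H → ({x, y, z} : Finset V) ∈ K) :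
    edgeSum H X Y Z ≤ 27 * (K.card : ℝ) := by
  rw [← card_filter_edge_eq_edgeSum]
  have : ((X ×ˢ Y ×ˢ Z).filter fun w => ({w.1, w.2.1, w.2.2} : Finset V) ∈ H) ⊆
      K.biUnion fun e => e ×ˢ e ×ˢ e := by
    rintro ⟨x, y, z⟩ hw
    simp only [Finset.mem_filter, Finset.mem_product] at hw
    simp only [Finset.mem_biUnion, Finset.mem_product]
    exact ⟨_, h x hw.1.1 y hw.1.2.1 z hw.1.2.2 hw.2, by simp, by simp, by simp⟩
  have h2 : (K.biUnion fun e => e ×ˢ e ×ˢ e).card ≤ K.card * 27 :=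
    Finset.card_biUnion_le_card_mul _ _ _ fun e he => by
      simp [Finset.card_product, hK e he]
  have := (Finset.card_le_card this).trans h2
  calc _ ≤ ((K.card * 27 : ℕ) : ℝ) := Nat.cast_le.2 this
    _ = _ := by push_cast; ring

lemma card_filter_subset_le_edgeSum {H : Finset (Finset V)} (hH : ∀ e ∈ H, e.card = 3)
    (B : Finset V) : ((H.filter fun e => e ⊆ B).card : ℝ) ≤ edgeSum H B B B := by
  rw [← card_filter_edge_eq_edgeSum]
  refine Nat.cast_le.2 (le_trans (Finset.card_le_card ?_)
    (Finset.card_image_le (f := fun w : V × V × V => ({w.1, w.2.1, w.2.2} : Finset V))))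
  intro e he
  rw [Finset.mem_filter] at he
  obtain ⟨x, y, z, -, -, -, rfl⟩ := Finset.card_eq_three.1 (hH e he.1)
  rw [Finset.mem_image]
  refine ⟨(x, y, z), ?_, rfl⟩
  have := he.2
  simp only [Finset.insert_subset_iff, Finset.singleton_subset_iff] at this
  simp [this, he.1]

lemma two_mul_degree_le_edgeSum [Fintype V] {H : Finset (Finset V)} (hH : ∀ e ∈ H, e.card = 3)
    (x : V) : 2 * ((H.filter fun e => x ∈ e).card : ℝ) ≤
      edgeSum H {x} Finset.univ Finset.univ := by
  rw [← card_filter_edge_eq_edgeSum]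
  have key := Finset.mul_card_image_le_card_of_maps_to
    (s := (({x} : Finset V) ×ˢ (Finset.univ : Finset V) ×ˢ (Finset.univ : Finset V)).filter
      fun w => ({w.1, w.2.1, w.2.2} : Finset V) ∈ H)
    (t := H.filter fun e => x ∈ e) (f := fun w => ({w.1, w.2.1, w.2.2} : Finset V)) ?_ 2 ?_
  · rw [mul_comm] at key
    calc 2 * ((H.filter fun e => x ∈ e).card : ℝ)
        = ((((H.filter fun e => x ∈ e).card * 2 : ℕ)) : ℝ) := by push_cast; ring
      _ ≤ _ := Nat.cast_le.2 (by rw [mul_comm]; rwa [mul_comm] at key)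
  · rintro ⟨a, b, c⟩ hw
    rw [Finset.mem_filter, Finset.mem_product, Finset.mem_singleton] at hw
    rw [Finset.mem_filter]
    have hax : a = x := hw.1.1
    exact ⟨hw.2, by simp [hax]⟩
  · intro e he
    rw [Finset.mem_filter] at he
    obtain ⟨y, z, hy, hz, hyz, rfl⟩ : ∃ y z, y ≠ x ∧ z ≠ x ∧ y ≠ z ∧ e = {x, y, z} := by
      obtain ⟨a, b, c, hab, hac, hbc, rfl⟩ := Finset.card_eq_three.1 (hH e he.1)
      have hx := he.2
      simp only [Finset.mem_insert, Finset.mem_singleton] at hx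
      rcases hx with rfl | rfl | rfl
      · exact ⟨b, c, hab.symm, hac.symm, hbc, rfl⟩
      · exact ⟨a, c, hab, hbc.symm, hac, by ext; simp; tauto⟩
      · exact ⟨a, b, hac, hbc, hab, by ext; simp; tauto⟩
    have hne : (x, y, z) ≠ (x, z, y) := by simp [hyz]
    rw [← Finset.card_pair hne]
    refine Finset.card_le_card ?_
    have hswap : ({x, z, y} : Finset V) = {x, y, z} := by ext; simp; tauto
    intro w hw
    simp only [Finset.mem_insert, Finset.mem_singleton] at hw
    rcases hw with rfl | rfl
    · simp [he.1]
    · simp [hswap, he.1]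

end Counting

section Matching

variable {V : Type} [DecidableEq V]

/-- Greedy selection of vertex-disjoint transversal edges: if each of the triples of parts
indexed by `J` is dense compared with how often its parts are used by the other triples, then
one can pick an edge through each triple so that all the picked edges are disjoint. -/
lemma exists_disjoint_transversals {κ J : Type*} [Fintype J] (H : Finset (Finset V))
    (S : κ → Finset V) (β : J → Fin 3 → κ)
    (hS : ∀ j a j' a', β j a ≠ β j' a' → Disjoint (S (β j a)) (S (β j' a')))
    (hβ : ∀ j, Function.Injective (β j)) {δ : ℝ}
    (hδ : 0 < δ)
    (hdense : ∀ j, 3 * δ * (S (β j 0)).card * (S (β j 1)).card * (S (β j 2)).card ≤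
      edgeSum H (S (β j 0)) (S (β j 1)) (S (β j 2)))
    (huse : ∀ j a, ((Finset.univ.filter fun j' => j' ≠ j ∧ ∃ a', β j' a' = β j a).card : ℝ) <
      δ * (S (β j a)).card) :
    ∃ e : J → Fin 3 → V, (∀ j a, e j a ∈ S (β j a)) ∧
      (∀ j, ({e j 0, e j 1, e j 2} : Finset V) ∈ H) ∧
      ∀ j j' a a', e j a = e j' a' → j = j' ∧ a = a' := by
  have hpart : ∀ {j a j' a' v}, v ∈ S (β j a) → v ∈ S (β j' a') → β j a = β j' a' := by
    intro j a j' a' v hj hj'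
    by_contra h
    exact Finset.disjoint_left.1 (hS j a j' a' h) hj hj'
  suffices h : ∀ A : Finset J, ∃ e : J → Fin 3 → V, ∀ j ∈ A, (∀ a, e j a ∈ S (β j a)) ∧
      ({e j 0, e j 1, e j 2} : Finset V) ∈ H ∧
      ∀ j' ∈ A, ∀ a a', e j a = e j' a' → j = j' ∧ a = a' by
    obtain ⟨e, he⟩ := h Finset.univ
    exact ⟨e, fun j => (he j (Finset.mem_univ _)).1, fun j => (he j (Finset.mem_univ _)).2.1,
      fun j j' => (he j (Finset.mem_univ _)).2.2 j' (Finset.mem_univ _)⟩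
  intro A
  induction A using Finset.induction_on with
  | empty =>
    by_cases hJ : Nonempty J
    · obtain ⟨j⟩ := hJ
      have hpos : 0 < δ * ((S (β j 0)).card : ℝ) := lt_of_le_of_lt (by positivity) (huse j 0)
      have hpos' : 0 < (S (β j 0)).card := by
        rcases Nat.eq_zero_or_pos (S (β j 0)).card with h | h
        · simp [h] at hpos
        · exact h
      obtain ⟨v, -⟩ := Finset.card_pos.1 hpos'
      exact ⟨fun _ _ => v, by simp⟩
    · exact ⟨fun j => (hJ ⟨j⟩).elim, by simp⟩
  | insert j A hj ih =>
    obtain ⟨e, he⟩ := ih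
    let F : Finset V := (A ×ˢ (Finset.univ : Finset (Fin 3))).image fun q => e q.1 q.2
    have hFmem : ∀ j' ∈ A, ∀ a, e j' a ∈ F := fun j' hj' a =>
      Finset.mem_image.2 ⟨(j', a), by simp [hj'], rfl⟩
    have hFcard : ∀ a, ((S (β j a) ∩ F).card : ℝ) < δ * (S (β j a)).card := by
      intro a
      refine lt_of_le_of_lt (Nat.cast_le.2 ?_) (huse j a)
      refine Finset.card_le_card_of_injOn
        (fun v => if h : ∃ j' ∈ A, ∃ a', e j' a' = v then h.choose else j) ?_ ?_
      · intro v hv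
        rw [Finset.mem_coe, Finset.mem_inter] at hv
        obtain ⟨⟨j', a'⟩, hq, hqv⟩ := Finset.mem_image.1 hv.2
        have hex : ∃ j' ∈ A, ∃ a', e j' a' = v := ⟨j', by simp at hq; exact hq, a', hqv⟩
        simp only [hex, dite_true]
        obtain ⟨hc1, a'', hc2⟩ := hex.choose_spec
        rw [Finset.mem_coe, Finset.mem_filter]
        refine ⟨Finset.mem_univ _, fun h => hj (h ▸ hc1), a'', ?_⟩
        exact hpart ((he _ hc1).1 a'') (by rw [hc2]; exact hv.1)
      · intro v hv v' hv' heq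
        rw [Finset.mem_coe, Finset.mem_inter] at hv hv'
        obtain ⟨⟨j₁, a₁⟩, hq₁, hqv₁⟩ := Finset.mem_image.1 hv.2
        obtain ⟨⟨j₂, a₂⟩, hq₂, hqv₂⟩ := Finset.mem_image.1 hv'.2
        have hex : ∃ j' ∈ A, ∃ a', e j' a' = v := ⟨j₁, by simp at hq₁; exact hq₁, a₁, hqv₁⟩
        have hex' : ∃ j' ∈ A, ∃ a', e j' a' = v' := ⟨j₂, by simp at hq₂; exact hq₂, a₂, hqv₂⟩
        simp only [hex, hex', dite_true] at heq
        obtain ⟨hc1, b, hc2⟩ := hex.choose_spec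
        obtain ⟨hc1', b', hc2'⟩ := hex'.choose_spec
        rw [← heq] at hc1' hc2'
        have h1 := hpart ((he _ hc1).1 b) (by rw [hc2]; exact hv.1)
        have h2 := hpart ((he _ hc1').1 b') (by rw [hc2']; exact hv'.1)
        have : b = b' := hβ _ (h1.trans h2.symm)
        rw [← hc2, ← hc2', this]
    obtain ⟨x, y, z, hx, hy, hz, hxF, hyF, hzF, hH⟩ : ∃ x y z, x ∈ S (β j 0) ∧ y ∈ S (β j 1) ∧
        z ∈ S (β j 2) ∧ x ∉ F ∧ y ∉ F ∧ z ∉ F ∧ ({x, y, z} : Finset V) ∈ H := by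
      by_contra hno
      push Not at hno
      have hsdiff : ∀ a, S (β j a) = (S (β j a) ∩ F) ∪ (S (β j a) \ F) := fun a => by
        ext v; simp; tauto
      have hzero : edgeSum H (S (β j 0) \ F) (S (β j 1) \ F) (S (β j 2) \ F) = 0 := by
        unfold edgeSum
        refine Finset.sum_eq_zero fun x hx => Finset.sum_eq_zero fun y hy =>
          Finset.sum_eq_zero fun z hz => ?_
        rw [Finset.mem_sdiff] at hx hy hz
        rw [if_neg (hno x y z hx.1 hy.1 hz.1 hx.2 hy.2 hz.2)]
      have hub : edgeSum H (S (β j 0)) (S (β j 1)) (S (β j 2)) ≤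
          edgeSum H (S (β j 0) ∩ F) (S (β j 1)) (S (β j 2)) +
          edgeSum H (S (β j 0)) (S (β j 1) ∩ F) (S (β j 2)) +
          edgeSum H (S (β j 0)) (S (β j 1)) (S (β j 2) ∩ F) := by
        have h1 := edgeSum_union_left_le H (S (β j 0) ∩ F) (S (β j 0) \ F) (S (β j 1)) (S (β j 2))
        rw [← hsdiff] at h1
        have h2 := edgeSum_union_left_le H (S (β j 1) ∩ F) (S (β j 1) \ F) (S (β j 0) \ F)
          (S (β j 2))
        rw [← hsdiff, edgeSum_swap_left, edgeSum_swap_left H (S (β j 1) ∩ F),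
          edgeSum_swap_left H (S (β j 1) \ F)] at h2
        have h3 := edgeSum_union_left_le H (S (β j 2) ∩ F) (S (β j 2) \ F) (S (β j 0) \ F)
          (S (β j 1) \ F)
        have hrot : ∀ W, edgeSum H W (S (β j 0) \ F) (S (β j 1) \ F) =
            edgeSum H (S (β j 0) \ F) (S (β j 1) \ F) W := fun W => by
          rw [edgeSum_swap_left, edgeSum_swap_right]
        rw [← hsdiff, hrot, hrot, hrot, hzero] at h3
        have h4 : edgeSum H (S (β j 0) \ F) (S (β j 1) ∩ F) (S (β j 2)) ≤
            edgeSum H (S (β j 0)) (S (β j 1) ∩ F) (S (β j 2)) :=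
          edgeSum_mono Finset.sdiff_subset subset_rfl subset_rfl
        have h5 : edgeSum H (S (β j 0) \ F) (S (β j 1) \ F) (S (β j 2) ∩ F) ≤
            edgeSum H (S (β j 0)) (S (β j 1)) (S (β j 2) ∩ F) :=
          edgeSum_mono Finset.sdiff_subset Finset.sdiff_subset subset_rfl
        linarith
      have e0 := edgeSum_le H (S (β j 0) ∩ F) (S (β j 1)) (S (β j 2))
      have e1 := edgeSum_le H (S (β j 0)) (S (β j 1) ∩ F) (S (β j 2))
      have e2 := edgeSum_le H (S (β j 0)) (S (β j 1)) (S (β j 2) ∩ F)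
      have hp : ∀ a, (0 : ℝ) < (S (β j a)).card := fun a =>
        pos_of_mul_pos_right (lt_of_le_of_lt (Nat.cast_nonneg _) (hFcard a)) hδ.le
      have hd := hdense j
      have f0 := hFcard 0
      have f1 := hFcard 1
      have f2 := hFcard 2
      have p0 := hp 0
      have p1 := hp 1
      have p2 := hp 2
      have g0 := mul_lt_mul_of_pos_right f0 (mul_pos p1 p2)
      have g1 := mul_lt_mul_of_pos_right f1 (mul_pos p0 p2)
      have g2 := mul_lt_mul_of_pos_right f2 (mul_pos p0 p1)
      nlinarith
    refine ⟨Function.update e j ![x, y, z], ?_⟩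
    have hnew : ∀ a, (![x, y, z] : Fin 3 → V) a ∈ S (β j a) := by
      intro a; fin_cases a <;> assumption
    have hnewF : ∀ a, (![x, y, z] : Fin 3 → V) a ∉ F := by
      intro a; fin_cases a <;> assumption
    have hne : ∀ j' ∈ A, j' ≠ j := fun j' h h' => hj (h' ▸ h)
    intro j₁ hj₁
    rw [Finset.mem_insert] at hj₁
    rcases hj₁ with rfl | hj₁
    · refine ⟨fun a => by simpa using hnew a, by simpa using hH, ?_⟩
      intro j₂ hj₂ a a' haa
      rw [Finset.mem_insert] at hj₂
      rcases hj₂ with rfl | hj₂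
      · simp only [Function.update_self] at haa
        exact ⟨rfl, hβ _ (hpart (hnew a) (haa ▸ hnew a'))⟩
      · rw [Function.update_self, Function.update_of_ne (hne _ hj₂)] at haa
        exact absurd (haa ▸ hFmem _ hj₂ a') (hnewF a)
    · simp only [Function.update_of_ne (hne _ hj₁)]
      refine ⟨(he _ hj₁).1, (he _ hj₁).2.1, ?_⟩
      intro j₂ hj₂ a a' haa
      rw [Finset.mem_insert] at hj₂
      rcases hj₂ with rfl | hj₂
      · rw [Function.update_self] at haa
        exact absurd (haa ▸ hFmem _ hj₁ a) (hnewF a')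
      · rw [Function.update_of_ne (hne _ hj₂)] at haa
        exact (he _ hj₁).2.2 _ hj₂ _ _ haa

/-- A family of disjoint edges is a tripartite cover with classes of size one. -/
lemma exists_triCover_of_matching {J : Type*} [Fintype J] (H : Finset (Finset V))
    (e : J → Fin 3 → V) (heH : ∀ j, ({e j 0, e j 1, e j 2} : Finset V) ∈ H)
    (hinj : ∀ j j' a a', e j a = e j' a' → j = j' ∧ a = a') :
    ∃ T' : Finset (Finset V × Finset V × Finset V), IsTriCover H T' ∧
      (∀ p ∈ T', p.1.card = 1 ∧ p.2.1.card = 1 ∧ p.2.2.card = 1) ∧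
      (coverVerts T').card = 3 * Fintype.card J := by
  let m : J → Finset V × Finset V × Finset V := fun j => ({e j 0}, {e j 1}, {e j 2})
  have hmem : ∀ j v, v ∈ triVerts (m j) ↔ ∃ a, e j a = v := by
    intro j v
    simp only [triVerts, m, Finset.mem_union, Finset.mem_singleton]
    constructor
    · rintro ((rfl | rfl) | rfl) <;> exact ⟨_, rfl⟩
    · rintro ⟨a, rfl⟩
      fin_cases a <;> simp
  refine ⟨Finset.univ.image m, ⟨?_, ?_⟩, ?_, ?_⟩
  · intro p hp
    obtain ⟨j, -, rfl⟩ := Finset.mem_image.1 hp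
    have hne : ∀ a b, a ≠ b → e j a ≠ e j b := fun a b h h' => h (hinj j j a b h').2
    refine ⟨?_, ?_, ?_, ?_⟩
    · simpa [m] using hne 0 1 (by decide)
    · simpa [m] using hne 0 2 (by decide)
    · simpa [m] using hne 1 2 (by decide)
    · simpa [m] using heH j
  · intro p hp q hq hpq
    simp only [Finset.coe_image, Finset.coe_univ, Set.image_univ, Set.mem_range] at hp hq
    obtain ⟨j, rfl⟩ := hp
    obtain ⟨j', rfl⟩ := hq
    refine Finset.disjoint_left.2 fun v hv hv' => hpq ?_
    obtain ⟨a, ha⟩ := (hmem j v).1 hv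
    obtain ⟨a', ha'⟩ := (hmem j' v).1 hv'
    rw [(hinj j j' a a' (ha.trans ha'.symm)).1]
  · intro p hp
    obtain ⟨j, -, rfl⟩ := Finset.mem_image.1 hp
    simp [m]
  · have : coverVerts (Finset.univ.image m) =
        (Finset.univ : Finset (J × Fin 3)).image fun q => e q.1 q.2 := by
      ext v
      rw [coverVerts, Finset.mem_biUnion, Finset.mem_image]
      constructor
      · rintro ⟨p, hp, hv⟩
        obtain ⟨j, -, rfl⟩ := Finset.mem_image.1 hp
        obtain ⟨a, ha⟩ := (hmem j v).1 hv
        exact ⟨(j, a), Finset.mem_univ _, ha⟩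
      · rintro ⟨⟨j, a⟩, -, hv⟩
        exact ⟨m j, Finset.mem_image_of_mem _ (Finset.mem_univ _), (hmem j v).2 ⟨a, hv⟩⟩
    rw [this, Finset.card_image_of_injective]
    · simp [mul_comm]
    · rintro ⟨j, a⟩ ⟨j', a'⟩ h
      obtain ⟨rfl, rfl⟩ := hinj j j' a a' h
      rfl

end Matching

section Gadget

variable {V : Type} [DecidableEq V]

/-- The uncovered set (`none`) or a class of a member of the cover. -/
def coverPart (I : Finset V) : Option ((Finset V × Finset V × Finset V) × Fin 3) → Finset V
  | none => I
  | some c => cls c.1 c.2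

/-- A set of members is augmentable if four dense triples of parts, disjoint outside `I`, can be
formed out of `I` and the classes of these members. -/
def IsAugmentable (H : Finset (Finset V)) (I : Finset V) (η : ℝ)
    (P : Finset (Finset V × Finset V × Finset V)) : Prop :=
  ∃ β : Fin 4 → Fin 3 → Option ((Finset V × Finset V × Finset V) × Fin 3),
    (∀ b, Function.Injective (β b)) ∧
    (∀ b b' a a' c, β b a = some c → β b' a' = some c → b = b') ∧
    (∀ b a c, β b a = some c → c.1 ∈ P) ∧
    ∀ b, 2 * η * (coverPart I (β b 0)).card * (coverPart I (β b 1)).card *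
        (coverPart I (β b 2)).card ≤
      edgeSum H (coverPart I (β b 0)) (coverPart I (β b 1)) (coverPart I (β b 2))

lemma mem_triVerts_iff {p : Finset V × Finset V × Finset V} {v : V} :
    v ∈ triVerts p ↔ ∃ a, v ∈ cls p a := by
  simp only [triVerts, Finset.mem_union]
  constructor
  · rintro ((h | h) | h)
    exacts [⟨0, h⟩, ⟨1, h⟩, ⟨2, h⟩]
  · rintro ⟨a, h⟩
    fin_cases a
    exacts [Or.inl (Or.inl h), Or.inl (Or.inr h), Or.inr h]

lemma cls_subset_triVerts (p : Finset V × Finset V × Finset V) (a : Fin 3) :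
    cls p a ⊆ triVerts p := fun _ hv => mem_triVerts_iff.2 ⟨a, hv⟩

lemma cls_subset_coverVerts {T : Finset (Finset V × Finset V × Finset V)}
    {p : Finset V × Finset V × Finset V} (hp : p ∈ T) (a : Fin 3) : cls p a ⊆ coverVerts T :=
  (cls_subset_triVerts p a).trans (Finset.subset_biUnion_of_mem triVerts hp)

lemma IsTriCover.disjoint_cls {H : Finset (Finset V)}
    {T : Finset (Finset V × Finset V × Finset V)} (hT : IsTriCover H T)
    {p q : Finset V × Finset V × Finset V} (hp : p ∈ T) (hq : q ∈ T) {a b : Fin 3}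
    (h : (p, a) ≠ (q, b)) : Disjoint (cls p a) (cls q b) := by
  by_cases hpq : p = q
  · subst hpq
    have hab : a ≠ b := fun hab => h (by rw [hab])
    obtain ⟨h1, h2, h3, -⟩ := hT.1 p hp
    fin_cases a <;> fin_cases b <;> first | exact absurd rfl hab | skip
    exacts [h1, h2, h1.symm, h3, h2.symm, h3.symm]
  · exact Disjoint.mono (cls_subset_triVerts p a) (cls_subset_triVerts q b) (hT.2 hp hq hpq)

omit [DecidableEq V] in
lemma card_cls {p : Finset V × Finset V × Finset V} {t : ℕ}
    (h : p.1.card = t ∧ p.2.1.card = t ∧ p.2.2.card = t) (a : Fin 3) : (cls p a).card = t := by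
  fin_cases a
  exacts [h.1, h.2.1, h.2.2]

lemma exists_larger_cover {H : Finset (Finset V)} {T : Finset (Finset V × Finset V × Finset V)}
    (hT : IsTriCover H T) {t : ℕ}
    (hsize : ∀ p ∈ T, p.1.card = t ∧ p.2.1.card = t ∧ p.2.2.card = t)
    {I : Finset V} (hI : Disjoint I (coverVerts T)) {η : ℝ} (hη : 0 < η) {l : ℕ} (hlt : l ≤ t)
    (hl : (l : ℝ) - 1 < 2 * η / 3 * t)
    (𝒢 : Finset (Finset (Finset V × Finset V × Finset V)))
    (h𝒢 : ∀ P ∈ 𝒢, P ⊆ T ∧ P.card = 3 ∧ IsAugmentable H I η P)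
    (hdisj : (𝒢 : Set (Finset (Finset V × Finset V × Finset V))).PairwiseDisjoint id)
    (hIcard : 4 * (𝒢.card : ℝ) * l < 2 * η / 3 * I.card) :
    ∃ T' : Finset (Finset V × Finset V × Finset V), IsTriCover H T' ∧
      (∀ p ∈ T', p.1.card = 1 ∧ p.2.1.card = 1 ∧ p.2.2.card = 1) ∧
      (coverVerts T').card = 3 * (T.card * t + 𝒢.card * l) := by
  have haug : ∀ g : 𝒢, IsAugmentable H I η g.1 := fun g => (h𝒢 g.1 g.2).2.2
  choose β hβinj hβdisj hβmem hβdense using haug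
  have hgT : ∀ (g : 𝒢) b a c, β g b a = some c → c.1 ∈ T := fun g b a c h =>
    (h𝒢 g.1 g.2).1 (hβmem g b a c h)
  have hgeq : ∀ (g g' : 𝒢) p, p ∈ g.1 → p ∈ g'.1 → g = g' := by
    intro g g' p hp hp'
    by_contra hne
    exact Finset.disjoint_left.1 (hdisj g.2 g'.2 fun h => hne (Subtype.ext h)) hp hp'
  have hpartdisj : ∀ (g : 𝒢) b a (g' : 𝒢) b' a', β g b a ≠ β g' b' a' →
      Disjoint (coverPart I (β g b a)) (coverPart I (β g' b' a')) := by
    intro g b a g' b' a' hne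
    rcases h : β g b a with _ | ⟨p, c⟩ <;> rcases h' : β g' b' a' with _ | ⟨p', c'⟩
    · exact absurd (h.trans h'.symm) hne
    · exact hI.mono_right (cls_subset_coverVerts (hgT g' b' a' _ h') c')
    · exact (hI.mono_right (cls_subset_coverVerts (hgT g b a _ h) c)).symm
    · refine hT.disjoint_cls (hgT g b a _ h) (hgT g' b' a' _ h') fun heq => hne ?_
      rw [h, h', heq]
  obtain ⟨e, heS, heH, heinj⟩ := exists_disjoint_transversals (J := 𝒢 × Fin 4 × Fin l)
    (δ := 2 * η / 3) H (coverPart I) (fun j => β j.1 j.2.1)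
    (fun j a j' a' => hpartdisj _ _ _ _ _ _) (fun j => hβinj _ _) (by positivity)
    (fun j => by
      have := hβdense j.1 j.2.1
      rw [show 3 * (2 * η / 3) = 2 * η by ring]
      exact this) (by
      rintro ⟨g, b, u⟩ a
      rcases h : β g b a with _ | c
      · refine lt_of_le_of_lt ?_ hIcard
        calc _ ≤ ((Fintype.card (𝒢 × Fin 4 × Fin l) : ℕ) : ℝ) :=
              Nat.cast_le.2 (Finset.card_le_univ _)
          _ = _ := by simp; ring
      · have hc : ((coverPart I (some c)).card : ℝ) = t := by
          exact_mod_cast card_cls (hsize _ (hgT g b a c h)) c.2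
        rw [hc]
        refine lt_of_le_of_lt ?_ hl
        have hsub : (Finset.univ.filter fun j' : 𝒢 × Fin 4 × Fin l =>
            j' ≠ (g, b, u) ∧ ∃ a', β j'.1 j'.2.1 a' = some c) ⊆
            ((Finset.univ : Finset (Fin l)).erase u).image fun u' => (g, b, u') := by
          rintro ⟨g', b', u'⟩ hj
          obtain ⟨-, hne, a', ha'⟩ := Finset.mem_filter.1 hj
          obtain rfl := hgeq g g' c.1 (hβmem g b a c h) (hβmem g' b' a' c ha')
          obtain rfl := hβdisj g b b' a a' c h ha'
          exact Finset.mem_image.2 ⟨u', Finset.mem_erase.2 ⟨fun hu => hne (by rw [hu]),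
            Finset.mem_univ _⟩, rfl⟩
        have h1 := (Finset.card_le_card hsub).trans Finset.card_image_le
        rw [Finset.card_erase_of_mem (Finset.mem_univ _), Finset.card_univ, Fintype.card_fin] at h1
        have hlpos : 1 ≤ l := Nat.one_le_of_lt u.2
        have h2 : ((l - 1 : ℕ) : ℝ) = l - 1 := by push_cast [hlpos]; ring
        rw [← h2]
        refine Nat.cast_le.2 ((Nat.le_of_eq ?_).trans h1)
        congr!)
  let U : Finset V := (Finset.univ : Finset ((𝒢 × Fin 4 × Fin l) × Fin 3)).image
    fun q => e q.1 q.2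
  let W : Finset (Finset V × Finset V × Finset V) := 𝒢.biUnion id
  let d : (Finset V × Finset V × Finset V) → ℕ := fun p => if p ∈ W then l else 0
  have hmemU : ∀ p ∈ T, ∀ a, ∀ v ∈ cls p a ∩ U, ∃ g b u a', e (g, b, u) a' = v ∧
      β g b a' = some (p, a) := by
    intro p hp a v hv
    rw [Finset.mem_inter] at hv
    obtain ⟨⟨⟨g, b, u⟩, a'⟩, -, rfl⟩ := Finset.mem_image.1 hv.2
    refine ⟨g, b, u, a', rfl, ?_⟩
    have hin : e (g, b, u) a' ∈ coverPart I (β g b a') := heS (g, b, u) a'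
    by_contra hne
    rcases h : β g b a' with _ | ⟨p', c'⟩
    · rw [h] at hin
      exact Finset.disjoint_left.1 hI hin (cls_subset_coverVerts hp a hv.1)
    · rw [h] at hin
      refine Finset.disjoint_left.1 (hT.disjoint_cls hp (hgT g b a' _ h) (a := a) (b := c') ?_)
        hv.1 hin
      intro heq
      exact hne (by rw [h, heq])
  have hcardU : ∀ p ∈ T, ∀ a, (cls p a ∩ U).card ≤ d p := by
    intro p hp a
    rcases (cls p a ∩ U).eq_empty_or_nonempty with h | ⟨v, hv⟩
    · simp [h]
    · obtain ⟨g, b, u, a', -, hβp⟩ := hmemU p hp a v hv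
      have hpW : p ∈ W := Finset.mem_biUnion.2 ⟨g.1, g.2, hβmem g b a' _ hβp⟩
      have hsub : cls p a ∩ U ⊆ (Finset.univ : Finset (Fin l)).image fun u' => e (g, b, u') a' := by
        intro v' hv'
        obtain ⟨g', b', u', a'', rfl, hβp'⟩ := hmemU p hp a v' hv'
        obtain rfl := hgeq g g' p (hβmem g b a' _ hβp) (hβmem g' b' a'' _ hβp')
        obtain rfl := hβdisj g b b' a' a'' _ hβp hβp'
        obtain rfl := hβinj g b (hβp.trans hβp'.symm)
        exact Finset.mem_image_of_mem _ (Finset.mem_univ _)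
      have := (Finset.card_le_card hsub).trans Finset.card_image_le
      simpa [d, hpW] using this
  have hemb : ∀ (p : T) (a : Fin 3), ∃ f : Fin (t - d p.1) → V, Function.Injective f ∧
      ∀ u, f u ∈ cls p.1 a \ U := by
    intro p a
    have h1 : t - d p.1 ≤ (cls p.1 a \ U).card := by
      have h2 := Finset.card_sdiff_add_card_inter (cls p.1 a) U
      have h3 := hcardU p.1 p.2 a
      have h4 := card_cls (hsize p.1 p.2) a
      omega
    have : Fintype.card (Fin (t - d p.1)) ≤ Fintype.card (cls p.1 a \ U : Finset V) := by
      simpa using h1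
    obtain ⟨f⟩ := Function.Embedding.nonempty_of_card_le this
    exact ⟨fun u => (f u).1, fun u u' h => f.injective (Subtype.ext h), fun u => (f u).2⟩
  choose f hfinj hfmem using hemb
  have hfU : ∀ p a u, f p a u ∉ U := fun p a u => (Finset.mem_sdiff.1 (hfmem p a u)).2
  have hfcls : ∀ p a u, f p a u ∈ cls p.1 a := fun p a u => (Finset.mem_sdiff.1 (hfmem p a u)).1
  have heU : ∀ j a, e j a ∈ U := fun j a => Finset.mem_image.2 ⟨(j, a), Finset.mem_univ _, rfl⟩
  let E : (𝒢 × Fin 4 × Fin l) ⊕ (Σ p : T, Fin (t - d p.1)) → Fin 3 → V :=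
    Sum.elim e fun q a => f q.1 a q.2
  obtain ⟨T', hT', hone, hcard⟩ := exists_triCover_of_matching H E (by
    rintro (j | ⟨p, u⟩)
    · exact heH j
    · exact (hT.1 p.1 p.2).2.2.2 _ (hfcls p 0 u) _ (hfcls p 1 u) _ (hfcls p 2 u)) (by
    rintro (j | ⟨p, u⟩) (j' | ⟨p', u'⟩) a a' h
    · obtain ⟨rfl, rfl⟩ := heinj j j' a a' h
      exact ⟨rfl, rfl⟩
    · replace h : e j a = f p' a' u' := h
      exact absurd (h ▸ heU j a) (hfU p' a' u')
    · replace h : f p a u = e j' a' := h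
      exact absurd (h ▸ heU j' a') (hfU p a u)
    · replace h : f p a u = f p' a' u' := h
      have hpa : (p.1, a) = (p'.1, a') := by
        by_contra hne
        exact Finset.disjoint_left.1 (hT.disjoint_cls p.2 p'.2 hne) (hfcls p a u)
          (h ▸ hfcls p' a' u')
      obtain ⟨hp, rfl⟩ := Prod.mk.inj hpa
      obtain rfl := Subtype.ext hp
      obtain rfl := hfinj p a h
      exact ⟨rfl, rfl⟩)
  refine ⟨T', hT', hone, ?_⟩
  have hd : ∀ p, d p ≤ t := fun p => by simp only [d]; split_ifs <;> omega
  have hWT : W ⊆ T := Finset.biUnion_subset.2 fun P hP => (h𝒢 P hP).1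
  have hWcard : W.card = 𝒢.card * 3 := by
    rw [Finset.card_biUnion fun x hx y hy hxy => hdisj hx hy hxy]
    exact Finset.sum_const_nat fun P hP => (h𝒢 P hP).2.1
  have hsumd : ∑ p ∈ T, d p = W.card * l := by
    simp only [d]
    rw [← Finset.sum_filter, Finset.sum_const, smul_eq_mul, Finset.filter_mem_eq_inter,
      Finset.inter_eq_right.2 hWT]
  have hsum : ∑ p ∈ T, (t - d p) + ∑ p ∈ T, d p = T.card * t := by
    rw [← Finset.sum_add_distrib]
    exact Finset.sum_const_nat fun p _ => Nat.sub_add_cancel (hd p)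
  rw [hcard]
  have hcardJ : Fintype.card ((𝒢 × Fin 4 × Fin l) ⊕ (Σ p : T, Fin (t - d p.1))) =
      𝒢.card * (4 * l) + ∑ p ∈ T, (t - d p) := by
    rw [Fintype.card_sum, Fintype.card_sigma]
    simp only [Fintype.card_prod, Fintype.card_coe, Fintype.card_fin]
    rw [Finset.sum_coe_sort T fun p => t - d p]
  rw [hcardJ]
  rw [hsumd, hWcard] at hsum
  nlinarith

end Gadget

section Link

variable {V : Type} [DecidableEq V]

/-- In the link graph of `(p, q)`, the edges are exactly the pairs that contain the class `a`
of `p` or the class `c` of `q`. -/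
def LinkCenters (H : Finset (Finset V)) (I : Finset V) (η : ℝ)
    (p q : Finset V × Finset V × Finset V) (a c : Fin 3) : Prop :=
  ∀ x y : Fin 3, ConnTo H I η (cls p x) (cls q y) ↔ x = a ∨ y = c

lemma connTo_iff {H : Finset (Finset V)} {I : Finset V} {η : ℝ} {P Q : Finset V} :
    ConnTo H I η P Q ↔ 2 * η * I.card * P.card * Q.card ≤ edgeSum H I P Q := by
  rw [ConnTo, card_filter_edge_eq_edgeSum]

lemma ConnTo.symm {H : Finset (Finset V)} {I : Finset V} {η : ℝ} {P Q : Finset V}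
    (h : ConnTo H I η P Q) : ConnTo H I η Q P := by
  rw [connTo_iff] at h ⊢
  rw [edgeSum_swap_right]
  linarith

lemma LinkCenters.symm {H : Finset (Finset V)} {I : Finset V} {η : ℝ}
    {p q : Finset V × Finset V × Finset V} {a c : Fin 3} (h : LinkCenters H I η p q a c) :
    LinkCenters H I η q p c a := fun x y =>
  ⟨fun hc => ((h y x).1 hc.symm).symm, fun hc => ((h y x).2 hc.symm).symm⟩

lemma LinkB311.exists_linkCenters {H : Finset (Finset V)} {I : Finset V} {η : ℝ}
    {p q : Finset V × Finset V × Finset V} (h : LinkB311 H I η p q) :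
    ∃ a c, LinkCenters H I η p q a c := by
  obtain ⟨f, g, hfg⟩ := h
  refine ⟨f 0, g 0, fun x y => (hfg x y).trans ?_⟩
  obtain ⟨i, rfl⟩ := f.surjective x
  obtain ⟨j, rfl⟩ := g.surjective y
  simp only [Finset.mem_insert, Finset.mem_singleton, Prod.mk.injEq, f.injective.eq_iff,
    g.injective.eq_iff]
  revert i j
  decide

lemma isAugmentable_of_pattern {H : Finset (Finset V)} {I : Finset V} {η : ℝ}
    {P : Finset (Finset V × Finset V × Finset V)}
    (m : Fin 3 → Finset V × Finset V × Finset V) (hm : Function.Injective m) (hmP : ∀ i, m i ∈ P)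
    (σ : Fin 3 → Fin 3 → Fin 3) (hσ : ∀ i, Function.Injective (σ i))
    (β : Fin 4 → Fin 3 → Option (Fin 3 × Fin 3))
    (hβ : ∀ b a a', β b a = β b a' → a = a')
    (hβ' : ∀ b b' a a' c, β b a = some c → β b' a' = some c → b = b')
    (hdense : ∀ b,
      2 * η * (coverPart I ((β b 0).map fun c => (m c.1, σ c.1 c.2))).card *
        (coverPart I ((β b 1).map fun c => (m c.1, σ c.1 c.2))).card *
        (coverPart I ((β b 2).map fun c => (m c.1, σ c.1 c.2))).card ≤
      edgeSum H (coverPart I ((β b 0).map fun c => (m c.1, σ c.1 c.2)))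
        (coverPart I ((β b 1).map fun c => (m c.1, σ c.1 c.2)))
        (coverPart I ((β b 2).map fun c => (m c.1, σ c.1 c.2)))) :
    IsAugmentable H I η P := by
  have hinj : Function.Injective fun c : Fin 3 × Fin 3 => (m c.1, σ c.1 c.2) := by
    rintro ⟨i, k⟩ ⟨i', k'⟩ h
    obtain ⟨h1, h2⟩ := Prod.mk.inj h
    obtain rfl := hm h1
    obtain rfl := hσ i h2
    rfl
  refine ⟨fun b a => (β b a).map fun c => (m c.1, σ c.1 c.2), ?_, ?_, ?_, ?_⟩
  · intro b a a' h
    exact hβ b a a' (Option.map_injective hinj h)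
  · intro b b' a a' c h h'
    obtain ⟨d, hd, hdc⟩ := Option.map_eq_some_iff.1 h
    obtain ⟨d', hd', hdc'⟩ := Option.map_eq_some_iff.1 h'
    have hdd : d = d' := hinj (hdc.trans hdc'.symm)
    rw [← hdd] at hd'
    exact hβ' b b' a a' d hd hd'
  · intro b a c h
    obtain ⟨d, -, hdc⟩ := Option.map_eq_some_iff.1 h
    rw [← hdc]
    exact hmP _
  · intro b
    exact hdense b

lemma exists_injective_vec_of_ne : ∀ a b : Fin 3, a ≠ b → ∃ c, Function.Injective ![a, b, c] := by
  decide

lemma exists_injective_vec : ∀ a : Fin 3, ∃ b c, Function.Injective ![a, b, c] := by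
  decide

lemma injective_vec_of_ne {α : Type*} {p q r : α} (hpq : p ≠ q) (hpr : p ≠ r) (hqr : q ≠ r) :
    Function.Injective ![p, q, r] := by
  intro i j h
  fin_cases i <;> fin_cases j <;> simp_all

lemma forall_fin_three_of {α : Type*} {f : α → Prop} {p q r : α} (hp : f p) (hq : f q)
    (hr : f r) : ∀ i, f (![p, q, r] i) := by
  intro i
  fin_cases i <;> assumption

lemma isAugmentable_of_ne_of_ne {H : Finset (Finset V)} {I : Finset V} {η : ℝ}
    {P : Finset (Finset V × Finset V × Finset V)} {p q r : Finset V × Finset V × Finset V}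
    (hp : p ∈ P) (hq : q ∈ P) (hr : r ∈ P) (hpq : p ≠ q) (hpr : p ≠ r) (hqr : q ≠ r)
    {a a' c c' d d' : Fin 3} (h1 : LinkCenters H I η p q a c) (h2 : LinkCenters H I η p r a' d)
    (h3 : LinkCenters H I η q r c' d') (haa : a ≠ a') (hcc : c ≠ c') :
    IsAugmentable H I η P := by
  obtain ⟨a₃, ha⟩ := exists_injective_vec_of_ne a a' haa
  obtain ⟨c₃, hc⟩ := exists_injective_vec_of_ne c c' hcc
  refine isAugmentable_of_pattern ![p, q, r] (injective_vec_of_ne hpq hpr hqr)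
    (forall_fin_three_of (f := (· ∈ P)) hp hq hr) ![![a, a', a₃], ![c, c', c₃], id]
    (forall_fin_three_of (f := Function.Injective) ha hc Function.injective_id)
    ![![none, some (1, 1), some (2, 0)], ![none, some (0, 0), some (1, 2)],
      ![none, some (0, 1), some (2, 1)], ![none, some (0, 2), some (1, 0)]]
    (by decide) (by decide) ?_
  intro b
  fin_cases b
  · exact connTo_iff.1 ((h3 c' 0).2 (Or.inl rfl))
  · exact connTo_iff.1 ((h1 a c₃).2 (Or.inl rfl))
  · exact connTo_iff.1 ((h2 a' 1).2 (Or.inl rfl))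
  · exact connTo_iff.1 ((h1 a₃ c).2 (Or.inr rfl))

/-- Three members whose pairwise links have inconsistent centers are augmentable. -/
lemma isAugmentable_of_ne {H : Finset (Finset V)} {I : Finset V} {η : ℝ}
    {P : Finset (Finset V × Finset V × Finset V)} {p q r : Finset V × Finset V × Finset V}
    (hp : p ∈ P) (hq : q ∈ P) (hr : r ∈ P) (hpq : p ≠ q) (hpr : p ≠ r) (hqr : q ≠ r)
    {a a' c c' d d' : Fin 3} (h1 : LinkCenters H I η p q a c) (h2 : LinkCenters H I η p r a' d)
    (h3 : LinkCenters H I η q r c' d') (haa : a ≠ a') : IsAugmentable H I η P := by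
  by_cases hcc : c = c'
  · by_cases hdd : d = d'
    · subst hcc hdd
      obtain ⟨a₃, ha⟩ := exists_injective_vec_of_ne a a' haa
      obtain ⟨c₂, c₃, hc⟩ := exists_injective_vec c
      obtain ⟨d₂, d₃, hd⟩ := exists_injective_vec d
      refine isAugmentable_of_pattern ![p, q, r] (injective_vec_of_ne hpq hpr hqr)
        (forall_fin_three_of (f := (· ∈ P)) hp hq hr) ![![a, a', a₃], ![c, c₂, c₃], ![d, d₂, d₃]]
        (forall_fin_three_of (f := Function.Injective) ha hc hd)
        ![![none, some (0, 0), some (1, 1)], ![none, some (0, 1), some (2, 1)],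
          ![none, some (1, 0), some (2, 2)], ![none, some (0, 2), some (2, 0)]]
        (by decide) (by decide) ?_
      intro b
      fin_cases b
      · exact connTo_iff.1 ((h1 a c₂).2 (Or.inl rfl))
      · exact connTo_iff.1 ((h2 a' d₂).2 (Or.inl rfl))
      · exact connTo_iff.1 ((h3 c d₃).2 (Or.inl rfl))
      · exact connTo_iff.1 ((h2 a₃ d).2 (Or.inr rfl))
    · exact isAugmentable_of_ne_of_ne hp hr hq hpr hpq hqr.symm h2 h1 h3.symm haa.symm hdd
  · exact isAugmentable_of_ne_of_ne hp hq hr hpq hpr hqr h1 h2 h3 haa hcc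

/-- Three members with consistent centers and a dense triple of classes avoiding the centers
are augmentable. -/
lemma isAugmentable_of_dense {H : Finset (Finset V)} {I : Finset V} {η : ℝ}
    {P : Finset (Finset V × Finset V × Finset V)} {p q r : Finset V × Finset V × Finset V}
    (hp : p ∈ P) (hq : q ∈ P) (hr : r ∈ P) (hpq : p ≠ q) (hpr : p ≠ r) (hqr : q ≠ r)
    {a c d : Fin 3} (h1 : LinkCenters H I η p q a c) (h2 : LinkCenters H I η p r a d)
    (h3 : LinkCenters H I η q r c d) {a' c' d' : Fin 3} (ha : a' ≠ a) (hc : c' ≠ c) (hd : d' ≠ d)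
    (hdense : 2 * η * (cls p a').card * (cls q c').card * (cls r d').card ≤
      edgeSum H (cls p a') (cls q c') (cls r d')) : IsAugmentable H I η P := by
  obtain ⟨a₃, ha⟩ := exists_injective_vec_of_ne a a' ha.symm
  obtain ⟨c₃, hc⟩ := exists_injective_vec_of_ne c c' hc.symm
  obtain ⟨d₃, hd⟩ := exists_injective_vec_of_ne d d' hd.symm
  refine isAugmentable_of_pattern ![p, q, r] (injective_vec_of_ne hpq hpr hqr)
    (forall_fin_three_of (f := (· ∈ P)) hp hq hr) ![![a, a', a₃], ![c, c', c₃], ![d, d', d₃]]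
    (forall_fin_three_of (f := Function.Injective) ha hc hd)
    ![![some (0, 1), some (1, 1), some (2, 1)], ![none, some (0, 0), some (1, 2)],
      ![none, some (1, 0), some (2, 2)], ![none, some (2, 0), some (0, 2)]]
    (by decide) (by decide) ?_
  intro b
  fin_cases b
  · exact hdense
  · exact connTo_iff.1 ((h1 a c₃).2 (Or.inl rfl))
  · exact connTo_iff.1 ((h3 c d₃).2 (Or.inl rfl))
  · exact connTo_iff.1 ((h2 a₃ d).2 (Or.inr rfl)).symm

end Link

section Structure

variable {V : Type} [DecidableEq V]

/-- If no three members with good pairwise links are augmentable, then the centers of the links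
can be chosen independently of the pair, up to a few exceptional pairs. -/
lemma exists_common_centers {H : Finset (Finset V)} {I : Finset V} {η : ℝ}
    {T : Finset (Finset V × Finset V × Finset V)} (hT : T.Nonempty)
    (Good : (Finset V × Finset V × Finset V) → (Finset V × Finset V × Finset V) → Prop)
    (hsymm : ∀ p q, Good p q → Good q p) (hne : ∀ p q, Good p q → p ≠ q)
    (hlink : ∀ p q, Good p q → ∃ a c, LinkCenters H I η p q a c)
    (hno : ∀ p q r, Good p q → Good p r → Good q r → ¬ IsAugmentable H I η {p, q, r}) :
    ∃ (A : (Finset V × Finset V × Finset V) → Fin 3)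
      (X : Finset ((Finset V × Finset V × Finset V) × (Finset V × Finset V × Finset V))),
      X.card ≤ 3 * ((T ×ˢ T).filter fun pq => ¬ Good pq.1 pq.2).card ∧
      ∀ p ∈ T, ∀ q ∈ T, (p, q) ∉ X → Good p q ∧ LinkCenters H I η p q (A p) (A q) := by
  set N := ((T ×ˢ T).filter fun pq => ¬ Good pq.1 pq.2).card with hN
  let X : (Finset V × Finset V × Finset V) →
      Finset ((Finset V × Finset V × Finset V) × (Finset V × Finset V × Finset V)) := fun r =>
    (T ×ˢ T).filter fun pq => ¬ (Good pq.1 pq.2 ∧ Good pq.1 r ∧ Good pq.2 r)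
  let S : (Finset V × Finset V × Finset V) → Finset (Finset V × Finset V × Finset V) := fun r =>
    T.filter fun p => ¬ Good r p
  have hS : ∑ r ∈ T, (S r).card = N := by
    rw [hN, Finset.card_filter, Finset.sum_product]
    exact Finset.sum_congr rfl fun r _ => Finset.card_filter _ _
  have hX : ∀ r ∈ T, (X r).card ≤ N + 2 * (T.card * (S r).card) := by
    intro r _
    have hsub : X r ⊆ ((T ×ˢ T).filter fun pq => ¬ Good pq.1 pq.2) ∪ (S r ×ˢ T ∪ T ×ˢ S r) := by
      rintro ⟨p, q⟩ h
      obtain ⟨hpq, hbad⟩ := Finset.mem_filter.1 h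
      obtain ⟨hp, hq⟩ := Finset.mem_product.1 hpq
      simp only [Finset.mem_union, Finset.mem_filter, Finset.mem_product, S]
      by_cases h1 : Good p q
      · by_cases h2 : Good p r
        · exact Or.inr (Or.inr ⟨hp, hq, fun h3 => hbad ⟨h1, h2, hsymm _ _ h3⟩⟩)
        · exact Or.inr (Or.inl ⟨⟨hp, fun h3 => h2 (hsymm _ _ h3)⟩, hq⟩)
      · exact Or.inl ⟨⟨hp, hq⟩, h1⟩
    have h1 := Finset.card_le_card hsub
    have h2 := Finset.card_union_le ((T ×ˢ T).filter fun pq => ¬ Good pq.1 pq.2)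
      (S r ×ˢ T ∪ T ×ˢ S r)
    have h3 := Finset.card_union_le (S r ×ˢ T) (T ×ˢ S r)
    rw [Finset.card_product, Finset.card_product] at h3
    rw [mul_comm (S r).card] at h3
    omega
  obtain ⟨r, hr, hrX⟩ : ∃ r ∈ T, (X r).card ≤ 3 * N := by
    refine Finset.exists_le_of_sum_le hT ?_
    calc ∑ r ∈ T, (X r).card ≤ ∑ r ∈ T, (N + 2 * (T.card * (S r).card)) := Finset.sum_le_sum hX
      _ = ∑ r ∈ T, 3 * N := by
        rw [Finset.sum_add_distrib, ← Finset.mul_sum, ← Finset.mul_sum, hS]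
        simp only [Finset.sum_const, smul_eq_mul]
        ring
  have hcenter : ∀ p, ∃ a, Good p r → ∃ d, LinkCenters H I η p r a d := by
    intro p
    by_cases h : Good p r
    · obtain ⟨a, d, had⟩ := hlink p r h
      exact ⟨a, fun _ => ⟨d, had⟩⟩
    · exact ⟨0, fun h' => absurd h' h⟩
  choose A hA using hcenter
  refine ⟨A, X r, hrX, fun p hp q hq hpq => ?_⟩
  have hgood : Good p q ∧ Good p r ∧ Good q r := by
    by_contra h
    exact hpq (Finset.mem_filter.2 ⟨Finset.mem_product.2 ⟨hp, hq⟩, h⟩)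
  obtain ⟨h1, h2, h3⟩ := hgood
  obtain ⟨a, c, hac⟩ := hlink p q h1
  obtain ⟨d, hd⟩ := hA p h2
  obtain ⟨d', hd'⟩ := hA q h3
  have ha : a = A p := by
    by_contra h
    exact hno p q r h1 h2 h3 (isAugmentable_of_ne (by simp) (by simp) (by simp) (hne _ _ h1)
      (hne _ _ h2) (hne _ _ h3) hac hd hd' h)
  have hc : c = A q := by
    by_contra h
    exact hno q p r (hsymm _ _ h1) h3 h2 (isAugmentable_of_ne (by simp) (by simp) (by simp)
      (hne _ _ h1).symm (hne _ _ h3) (hne _ _ h2) hac.symm hd' hd h)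
  exact ⟨h1, ha ▸ hc ▸ hac⟩

lemma IsTriCover.card_triVerts {H : Finset (Finset V)}
    {T : Finset (Finset V × Finset V × Finset V)} (hT : IsTriCover H T) {t : ℕ}
    (hsize : ∀ p ∈ T, p.1.card = t ∧ p.2.1.card = t ∧ p.2.2.card = t)
    {p : Finset V × Finset V × Finset V} (hp : p ∈ T) : (triVerts p).card = 3 * t := by
  obtain ⟨h1, h2, h3, -⟩ := hT.1 p hp
  obtain ⟨s1, s2, s3⟩ := hsize p hp
  rw [triVerts, Finset.card_union_of_disjoint (Finset.disjoint_union_left.2 ⟨h2, h3⟩),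
    Finset.card_union_of_disjoint h1]
  omega

lemma IsTriCover.card_biUnion_triVerts {H : Finset (Finset V)}
    {T : Finset (Finset V × Finset V × Finset V)} (hT : IsTriCover H T) {t : ℕ}
    (hsize : ∀ p ∈ T, p.1.card = t ∧ p.2.1.card = t ∧ p.2.2.card = t)
    {T₀ : Finset (Finset V × Finset V × Finset V)} (hT₀ : T₀ ⊆ T) :
    (T₀.biUnion triVerts).card = T₀.card * (3 * t) := by
  rw [Finset.card_biUnion fun x hx y hy hxy => hT.2 (hT₀ hx) (hT₀ hy) hxy]
  exact Finset.sum_const_nat fun p hp => hT.card_triVerts hsize (hT₀ hp)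

lemma edgeSum_le_sum_cls (H : Finset (Finset V)) (T : Finset (Finset V × Finset V × Finset V))
    (s : Finset V × Finset V × Finset V → Finset (Fin 3)) {D I : Finset V}
    (hD : D ⊆ I ∪ T.biUnion fun p => (s p).biUnion (cls p)) (Y Z : Finset V) :
    edgeSum H D Y Z ≤ edgeSum H I Y Z + ∑ p ∈ T, ∑ a ∈ s p, edgeSum H (cls p a) Y Z := by
  refine (edgeSum_mono hD subset_rfl subset_rfl).trans ((edgeSum_union_left_le _ _ _ _ _).trans ?_)
  gcongr
  refine (edgeSum_biUnion_left_le _ _ _ _ _).trans (Finset.sum_le_sum fun p _ => ?_)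
  exact edgeSum_biUnion_left_le _ _ _ _ _

lemma edgeSum_rotate (H : Finset (Finset V)) (X Y Z : Finset V) :
    edgeSum H X Y Z = edgeSum H Y Z X := by
  rw [edgeSum_swap_left, edgeSum_swap_right]

lemma edgeSum_le_of_not_heavy {H : Finset (Finset V)} (hH : ∀ e ∈ H, e.card = 3)
    {I W : Finset V} (hIW : Disjoint I W) {η : ℝ} (hη : 0 ≤ η) (hW : ¬ Heavy H I η W) :
    edgeSum H I I W ≤ 27 * η * W.card * I.card ^ 2 := by
  rw [Heavy, not_le] at hW
  have h1 : edgeSum H I I W ≤ 27 *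
      ((H.filter fun e => (e ∩ W).card = 1 ∧ (e ∩ I).card = 2).card : ℝ) := by
    refine edgeSum_le_of_forall_mem (fun e he => hH e (Finset.mem_filter.1 he).1) ?_
    intro x hx y hy z hz he
    have hxW := Finset.disjoint_left.1 hIW hx
    have hyW := Finset.disjoint_left.1 hIW hy
    have hzI := Finset.disjoint_right.1 hIW hz
    have hxy : x ≠ y := by
      rintro rfl
      have h3 := hH _ he
      rw [Finset.insert_eq_of_mem (Finset.mem_insert_self _ _)] at h3
      have := Finset.card_le_two (a := x) (b := z)
      omega
    have e1 : ({x, y, z} : Finset V) ∩ W = {z} := by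
      ext v
      simp only [Finset.mem_inter, Finset.mem_insert, Finset.mem_singleton]
      constructor
      · rintro ⟨rfl | rfl | rfl, hv⟩
        exacts [absurd hv hxW, absurd hv hyW, rfl]
      · rintro rfl
        exact ⟨Or.inr (Or.inr rfl), hz⟩
    have e2 : ({x, y, z} : Finset V) ∩ I = {x, y} := by
      ext v
      simp only [Finset.mem_inter, Finset.mem_insert, Finset.mem_singleton]
      constructor
      · rintro ⟨rfl | rfl | rfl, hv⟩
        exacts [Or.inl rfl, Or.inr rfl, absurd hv hzI]
      · rintro (rfl | rfl)
        exacts [⟨Or.inl rfl, hx⟩, ⟨Or.inr (Or.inl rfl), hy⟩]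
    refine Finset.mem_filter.2 ⟨he, ?_, ?_⟩
    · rw [e1, Finset.card_singleton]
    · rw [e2, Finset.card_pair hxy]
  have h2 : (I.card.choose 2 : ℝ) ≤ I.card ^ 2 / 2 := by
    have := Nat.choose_le_pow_div (α := ℝ) 2 I.card
    simpa using this
  have h3 : 2 * η * W.card * (I.card.choose 2 : ℝ) ≤ 2 * η * W.card * (I.card ^ 2 / 2) := by
    gcongr
  linarith

lemma sum_heavy_le {H : Finset (Finset V)} {I : Finset V} {η : ℝ}
    {p : Finset V × Finset V × Finset V} (hp : ¬ TwoSided H I η p) {f : Fin 3 → ℝ} {x y : ℝ}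
    (hf : ∀ a, f a ≤ x) (hf' : ∀ a, ¬ Heavy H I η (cls p a) → f a ≤ y) :
    ∑ a, f a ≤ x + 2 * y := by
  rw [Fin.sum_univ_three]
  have f0 := hf 0
  have f1 := hf 1
  have f2 := hf 2
  have g0 := hf' 0
  have g1 := hf' 1
  have g2 := hf' 2
  change ¬ Heavy H I η p.1 → _ at g0
  change ¬ Heavy H I η p.2.1 → _ at g1
  change ¬ Heavy H I η p.2.2 → _ at g2
  clear hf hf'
  unfold TwoSided at hp
  by_cases h0 : Heavy H I η p.1 <;> by_cases h1 : Heavy H I η p.2.1 <;>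
    by_cases h2 : Heavy H I η p.2.2 <;> simp_all <;> linarith

lemma sum_link_le {f : Fin 3 → Fin 3 → ℝ} {a c : Fin 3} {x y : ℝ} (hy : 0 ≤ y)
    (hf : ∀ i j, f i j ≤ x) (hf' : ∀ i j, i ≠ a → j ≠ c → f i j ≤ y) :
    ∑ i, ∑ j, f i j ≤ 5 * x + 9 * y := by
  have h : ∀ i j, f i j ≤ (if i = a ∨ j = c then x else 0) + y := by
    intro i j
    split_ifs with h
    · linarith [hf i j]
    · rw [not_or] at h
      linarith [hf' i j h.1 h.2]
  calc ∑ i, ∑ j, f i j ≤ ∑ i, ∑ j, ((if i = a ∨ j = c then x else 0) + y) :=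
        Finset.sum_le_sum fun i _ => Finset.sum_le_sum fun j _ => h i j
    _ = 5 * x + 9 * y := by
      simp only [Fin.sum_univ_three]
      fin_cases a <;> fin_cases c <;> simp <;> ring

end Structure

lemma le_mul_of_degree_estimate {n u w s : ℝ} (hu : 0 ≤ u) (hw : 0 ≤ w) (hs : 0 ≤ s)
    (hs' : s ≤ 1 / 60) (hn : 1 ≤ s * n) (hcov : n = 3 * u + w)
    (key : (5 / 9 - 10 * s ^ 2) * (n * (n - 1)) ≤
      27 / 6 * s ^ 2 * w ^ 2 + 2 * (u * w * (1 + 56 * s ^ 2)) +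
        (u ^ 2 * (5 + 18 * s ^ 2) + 81 * s * u ^ 2)) :
    w ≤ 25 * s * n := by
  have hn0 : 0 < n := by
    by_contra h
    have := mul_nonpos_of_nonneg_of_nonpos hs (not_lt.1 h)
    linarith
  have huw : 0 ≤ u * w := mul_nonneg hu hw
  have hss : s ^ 2 ≤ s / 60 := by
    have := mul_le_mul_of_nonneg_left hs' hs
    linarith
  have h1 : s ^ 2 * n ^ 2 ≤ s / 60 * n ^ 2 := mul_le_mul_of_nonneg_right hss (sq_nonneg n)
  have h2 : n ≤ s * n ^ 2 := by
    have := mul_le_mul_of_nonneg_right hn hn0.le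
    linarith
  have h3 : s ^ 2 * (27 / 6 * w ^ 2 + 112 * (u * w) + 18 * u ^ 2) ≤ s ^ 2 * (19 * n ^ 2) := by
    refine mul_le_mul_of_nonneg_left ?_ (sq_nonneg s)
    have : 19 * n ^ 2 = 171 * u ^ 2 + 114 * (u * w) + 19 * w ^ 2 := by rw [hcov]; ring
    linarith [sq_nonneg u, sq_nonneg w]
  have h4 : s * u ^ 2 ≤ s * (n ^ 2 / 9) := by
    refine mul_le_mul_of_nonneg_left ?_ hs
    have : n ^ 2 / 9 = u ^ 2 + 2 / 3 * (u * w) + w ^ 2 / 9 := by rw [hcov]; ring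
    linarith [sq_nonneg w]
  have h5 : 5 / 9 * n ^ 2 = 5 * u ^ 2 + 2 * (u * w) + 4 / 9 * (w * n) + 1 / 9 * w ^ 2 := by
    rw [hcov]; ring
  have h6 : 0 ≤ s ^ 2 * n := by positivity
  have h7 : w * n ≤ 25 * s * n * n := by
    have h8 : 0 ≤ s * n ^ 2 := by positivity
    linarith [sq_nonneg w]
  exact le_of_mul_le_mul_right h7 hn0

section Extremal

variable {V : Type} [DecidableEq V]

lemma sum_edgeSum_one_le {H : Finset (Finset V)} (hH : ∀ e ∈ H, e.card = 3)
    {T : Finset (Finset V × Finset V × Finset V)} (hT : IsTriCover H T) {t : ℕ}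
    (hsize : ∀ p ∈ T, p.1.card = t ∧ p.2.1.card = t ∧ p.2.2.card = t) (ht : 0 < t)
    {I : Finset V} (hI : Disjoint I (coverVerts T)) {η : ℝ} (hη : 0 ≤ η)
    (htwo : (((T.filter fun p => TwoSided H I η p).biUnion triVerts).card : ℝ) ≤
      η * ((coverVerts T).card : ℝ)) :
    ∑ p ∈ T, ∑ a, edgeSum H I I (cls p a) ≤ T.card * t * I.card ^ 2 * (1 + 56 * η) := by
  have hp : ∀ p ∈ T, ∑ a, edgeSum H I I (cls p a) ≤
      t * (I.card : ℝ) ^ 2 * (1 + 54 * η) +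
        if TwoSided H I η p then 2 * t * (I.card : ℝ) ^ 2 else 0 := by
    intro p hp
    have hle : ∀ a, edgeSum H I I (cls p a) ≤ t * (I.card : ℝ) ^ 2 := by
      intro a
      refine (edgeSum_le _ _ _ _).trans_eq ?_
      rw [card_cls (hsize p hp)]
      ring
    split_ifs with h
    · have : 0 ≤ t * (I.card : ℝ) ^ 2 * (54 * η) := by positivity
      rw [Fin.sum_univ_three]
      linarith [hle 0, hle 1, hle 2]
    · refine (sum_heavy_le h (y := 27 * η * t * (I.card : ℝ) ^ 2) hle
        fun a ha => ?_).trans_eq (by ring)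
      have := edgeSum_le_of_not_heavy hH (hI.mono_right (cls_subset_coverVerts hp a)) hη ha
      rwa [card_cls (hsize p hp)] at this
  refine (Finset.sum_le_sum hp).trans ?_
  rw [Finset.sum_add_distrib, Finset.sum_const, ← Finset.sum_filter, Finset.sum_const,
    nsmul_eq_mul, nsmul_eq_mul]
  rw [hT.card_biUnion_triVerts hsize (Finset.filter_subset _ _), coverVerts,
    hT.card_biUnion_triVerts hsize subset_rfl] at htwo
  push_cast at htwo
  have ht' : (0 : ℝ) < t := Nat.cast_pos.2 ht
  have h1 : ((T.filter fun p => TwoSided H I η p).card : ℝ) ≤ η * T.card := by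
    have : (0 : ℝ) < 3 * t := by positivity
    refine le_of_mul_le_mul_right ?_ this
    linarith
  have h2 : ((T.filter fun p => TwoSided H I η p).card : ℝ) * (2 * t * (I.card : ℝ) ^ 2) ≤
      η * T.card * (2 * t * (I.card : ℝ) ^ 2) := by gcongr
  linarith

lemma sum_indicator_le {α : Type*} [DecidableEq α] (T : Finset α) (X : Finset (α × α)) :
    ∑ p ∈ T, ∑ q ∈ T, (if (p, q) ∈ X then (1 : ℝ) else 0) ≤ X.card := by
  rw [← Finset.sum_product' (s := T) (t := T) (f := fun p q => if (p, q) ∈ X then (1 : ℝ) else 0),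
    Finset.sum_boole]
  exact Nat.cast_le.2 (Finset.card_le_card fun x hx => (Finset.mem_filter.1 hx).2)

lemma sum_edgeSum_two_le {H : Finset (Finset V)}
    {T : Finset (Finset V × Finset V × Finset V)} {t : ℕ}
    (hsize : ∀ p ∈ T, p.1.card = t ∧ p.2.1.card = t ∧ p.2.2.card = t)
    {I : Finset V} {η : ℝ} (hη : 0 ≤ η) {A : (Finset V × Finset V × Finset V) → Fin 3}
    {X : Finset ((Finset V × Finset V × Finset V) × (Finset V × Finset V × Finset V))}
    (hX : ∀ p ∈ T, ∀ q ∈ T, (p, q) ∉ X → LinkCenters H I η p q (A p) (A q)) :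
    ∑ p ∈ T, ∑ q ∈ T, ∑ a, ∑ b, edgeSum H I (cls p a) (cls q b) ≤
      I.card * (t : ℝ) ^ 2 * ((T.card : ℝ) ^ 2 * (5 + 18 * η) + 9 * X.card) := by
  have hpq : ∀ p ∈ T, ∀ q ∈ T, ∑ a, ∑ b, edgeSum H I (cls p a) (cls q b) ≤
      I.card * (t : ℝ) ^ 2 * ((5 + 18 * η) + 9 * if (p, q) ∈ X then 1 else 0) := by
    intro p hp q hq
    have hle : ∀ a b, edgeSum H I (cls p a) (cls q b) ≤ I.card * (t : ℝ) ^ 2 := by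
      intro a b
      refine (edgeSum_le _ _ _ _).trans_eq ?_
      rw [card_cls (hsize p hp), card_cls (hsize q hq)]
      ring
    split_ifs with h
    · calc ∑ a, ∑ b, edgeSum H I (cls p a) (cls q b)
          ≤ ∑ a : Fin 3, ∑ b : Fin 3, I.card * (t : ℝ) ^ 2 :=
            Finset.sum_le_sum fun a _ => Finset.sum_le_sum fun b _ => hle a b
        _ = I.card * (t : ℝ) ^ 2 * 9 := by
          simp only [Finset.sum_const, Finset.card_univ, Fintype.card_fin, nsmul_eq_mul]
          push_cast
          ring
        _ ≤ I.card * (t : ℝ) ^ 2 * ((5 + 18 * η) + 9 * 1) := by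
          gcongr
          linarith
    · refine (sum_link_le (a := A p) (c := A q) (y := 2 * η * I.card * t * t) (by positivity) hle
        fun a b ha hb => ?_).trans_eq (by ring)
      have hc := mt (hX p hp q hq h a b).1 (not_or.2 ⟨ha, hb⟩)
      rw [connTo_iff, not_le, card_cls (hsize p hp), card_cls (hsize q hq)] at hc
      exact hc.le
  refine (Finset.sum_le_sum fun p hp => Finset.sum_le_sum (hpq p hp)).trans ?_
  simp only [← Finset.mul_sum, Finset.sum_add_distrib, Finset.sum_const, nsmul_eq_mul]
  refine mul_le_mul_of_nonneg_left ?_ (by positivity)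
  linarith [sum_indicator_le T X]

variable [Fintype V]

lemma edgeSum_univ_le {H : Finset (Finset V)} {T : Finset (Finset V × Finset V × Finset V)}
    {I : Finset V} (hI : I = Finset.univ \ coverVerts T) :
    edgeSum H I Finset.univ Finset.univ ≤ edgeSum H I I I +
      2 * ∑ p ∈ T, ∑ a, edgeSum H I I (cls p a) +
      ∑ p ∈ T, ∑ q ∈ T, ∑ a, ∑ b, edgeSum H I (cls p a) (cls q b) := by
  have hU : (Finset.univ : Finset V) ⊆ I ∪ T.biUnion fun p => Finset.univ.biUnion (cls p) := by
    intro v _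
    by_cases hv : v ∈ coverVerts T
    · obtain ⟨p, hp, hvp⟩ := Finset.mem_biUnion.1 hv
      obtain ⟨a, ha⟩ := mem_triVerts_iff.1 hvp
      exact Finset.mem_union_right _ (Finset.mem_biUnion.2
        ⟨p, hp, Finset.mem_biUnion.2 ⟨a, Finset.mem_univ a, ha⟩⟩)
    · exact Finset.mem_union_left _ (by simp [hI, hv])
  have h1 := edgeSum_le_sum_cls H T (fun _ => Finset.univ) hU I Finset.univ
  have h2 := edgeSum_le_sum_cls H T (fun _ => Finset.univ) hU I I
  have h3 : ∀ p ∈ T, ∀ a, edgeSum H (cls p a) I Finset.univ ≤ edgeSum H I I (cls p a) +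
      ∑ q ∈ T, ∑ b, edgeSum H I (cls p a) (cls q b) := by
    intro p _ a
    have h := edgeSum_le_sum_cls H T (fun _ => Finset.univ) hU I (cls p a)
    rw [edgeSum_rotate, edgeSum_swap_left] at h
    refine h.trans (add_le_add_right (Finset.sum_le_sum fun q _ =>
      Finset.sum_le_sum fun b _ => (edgeSum_rotate H _ _ _).le) _)
  have h4 := Finset.sum_le_sum fun p hp => Finset.sum_le_sum fun a (_ : a ∈ Finset.univ) =>
    h3 p hp a
  simp only [Finset.sum_add_distrib] at h4
  rw [Finset.sum_congr rfl fun p _ => Finset.sum_comm (s := Finset.univ) (t := T)] at h4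
  rw [Finset.sum_congr rfl fun p _ => Finset.sum_congr rfl fun a _ =>
    edgeSum_rotate H (cls p a) I I, edgeSum_rotate] at h2
  rw [edgeSum_swap_left] at h1
  linarith

/-- Under the degree condition, common centers for the links force the uncovered set to be
small. -/
lemma card_uncovered_le {H : Finset (Finset V)} (hH : ∀ e ∈ H, e.card = 3)
    {T : Finset (Finset V × Finset V × Finset V)} (hT : IsTriCover H T) {t : ℕ}
    (hsize : ∀ p ∈ T, p.1.card = t ∧ p.2.1.card = t ∧ p.2.2.card = t) (ht : 0 < t)
    {I : Finset V} (hI : I = Finset.univ \ coverVerts T) {s : ℝ} (hs : 0 ≤ s) (hs' : s ≤ 1 / 60)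
    (hn : 1 ≤ s * Fintype.card V)
    (hdeg : ∀ v : V, (5 / 9 - 10 * s ^ 2) * ((Fintype.card V).choose 2 : ℝ) ≤
      ((H.filter fun e => v ∈ e).card : ℝ))
    (hsparse : ((H.filter fun e => e ⊆ I).card : ℝ) ≤ s ^ 2 * (I.card.choose 3 : ℝ))
    (htwo : (((T.filter fun p => TwoSided H I (s ^ 2) p).biUnion triVerts).card : ℝ) ≤
      s ^ 2 * ((coverVerts T).card : ℝ))
    {A : (Finset V × Finset V × Finset V) → Fin 3}
    {X : Finset ((Finset V × Finset V × Finset V) × (Finset V × Finset V × Finset V))}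
    (hXcard : (X.card : ℝ) ≤ 9 * s * (T.card : ℝ) ^ 2)
    (hX : ∀ p ∈ T, ∀ q ∈ T, (p, q) ∉ X → LinkCenters H I (s ^ 2) p q (A p) (A q)) :
    (I.card : ℝ) ≤ 25 * s * Fintype.card V := by
  have hdisj : Disjoint I (coverVerts T) := hI ▸ Finset.sdiff_disjoint
  have hη : 0 ≤ s ^ 2 := sq_nonneg s
  have hlow : (I.card : ℝ) * ((5 / 9 - 10 * s ^ 2) *
      (Fintype.card V * (Fintype.card V - 1))) ≤ edgeSum H I Finset.univ Finset.univ := by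
    have h1 : ∀ x ∈ I, (5 / 9 - 10 * s ^ 2) * (Fintype.card V * ((Fintype.card V : ℝ) - 1)) ≤
        edgeSum H {x} Finset.univ Finset.univ := by
      intro x _
      have h2 := hdeg x
      rw [Nat.cast_choose_two] at h2
      linarith [two_mul_degree_le_edgeSum hH x]
    have h2 := Finset.card_nsmul_le_sum I _ _ h1
    rw [nsmul_eq_mul] at h2
    refine h2.trans_eq ?_
    simp only [edgeSum, Finset.sum_singleton]
  have hup := edgeSum_univ_le (H := H) hI
  have hIII : edgeSum H I I I ≤ 27 / 6 * s ^ 2 * (I.card : ℝ) ^ 3 := by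
    have h1 : edgeSum H I I I ≤ 27 * ((H.filter fun e => e ⊆ I).card : ℝ) := by
      refine edgeSum_le_of_forall_mem (fun e he => hH e (Finset.mem_filter.1 he).1) ?_
      intro x hx y hy z hz he
      exact Finset.mem_filter.2 ⟨he, by simp [Finset.insert_subset_iff, hx, hy, hz]⟩
    have h2 : (I.card.choose 3 : ℝ) ≤ (I.card : ℝ) ^ 3 / 6 := by
      have := Nat.choose_le_pow_div (α := ℝ) 3 I.card
      simpa [Nat.factorial] using this
    have h3 := mul_le_mul_of_nonneg_left h2 hη
    linarith
  have hone := sum_edgeSum_one_le hH hT hsize ht hdisj hη htwo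
  have htwo' := sum_edgeSum_two_le hsize hη hX
  have hcov : (Fintype.card V : ℝ) = 3 * (T.card * t) + I.card := by
    have h1 : (coverVerts T).card = T.card * (3 * t) := hT.card_biUnion_triVerts hsize subset_rfl
    have h2 := Finset.card_sdiff_add_card_eq_card (Finset.subset_univ (coverVerts T))
    rw [← hI, h1, Finset.card_univ] at h2
    rw [← h2]
    push_cast
    ring
  rcases Nat.eq_zero_or_pos I.card with h0 | hpos
  · rw [h0]
    push_cast
    positivity
  have hw : (0 : ℝ) < I.card := Nat.cast_pos.2 hpos
  have hv : (0 : ℝ) ≤ T.card * t := by positivity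
  have hXt : (t : ℝ) ^ 2 * (9 * X.card) ≤ 81 * s * (T.card * t : ℝ) ^ 2 := by
    have := mul_le_mul_of_nonneg_left hXcard (sq_nonneg (t : ℝ))
    linarith
  have hXw := mul_le_mul_of_nonneg_left hXt hw.le
  refine le_mul_of_degree_estimate hv hw.le hs hs' hn hcov (le_of_mul_le_mul_left ?_ hw)
  linarith

end Extremal

section ExtremalSet

variable {V : Type} [DecidableEq V]

lemma edgeSum_cls_le_of_not_isAugmentable {H : Finset (Finset V)}
    {T : Finset (Finset V × Finset V × Finset V)} {t : ℕ}
    (hsize : ∀ p ∈ T, p.1.card = t ∧ p.2.1.card = t ∧ p.2.2.card = t)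
    {I : Finset V} {η : ℝ} (hη : 0 ≤ η) {A : (Finset V × Finset V × Finset V) → Fin 3}
    {X : Finset ((Finset V × Finset V × Finset V) × (Finset V × Finset V × Finset V))}
    (hne : ∀ p ∈ T, ∀ q ∈ T, (p, q) ∉ X → p ≠ q)
    (hX : ∀ p ∈ T, ∀ q ∈ T, (p, q) ∉ X → LinkCenters H I η p q (A p) (A q))
    (hno : ∀ p ∈ T, ∀ q ∈ T, ∀ r ∈ T, (p, q) ∉ X → (p, r) ∉ X → (q, r) ∉ X →
      ¬ IsAugmentable H I η {p, q, r})
    {p q r : Finset V × Finset V × Finset V} (hp : p ∈ T) (hq : q ∈ T) (hr : r ∈ T)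
    {a b c : Fin 3} (ha : a ≠ A p) (hb : b ≠ A q) (hc : c ≠ A r) :
    edgeSum H (cls p a) (cls q b) (cls r c) ≤ (t : ℝ) ^ 3 * (2 * η +
      (if (p, q) ∈ X then 1 else 0) + (if (p, r) ∈ X then 1 else 0) +
      (if (q, r) ∈ X then 1 else 0)) := by
  by_cases h : (p, q) ∈ X ∨ (p, r) ∈ X ∨ (q, r) ∈ X
  · have h1 : edgeSum H (cls p a) (cls q b) (cls r c) ≤ (t : ℝ) ^ 3 * 1 := by
      refine (edgeSum_le _ _ _ _).trans_eq ?_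
      rw [card_cls (hsize p hp), card_cls (hsize q hq), card_cls (hsize r hr)]
      ring
    refine h1.trans (mul_le_mul_of_nonneg_left ?_ (by positivity))
    split_ifs <;> first | linarith | simp_all
  · simp only [not_or] at h
    obtain ⟨h1, h2, h3⟩ := h
    by_contra hlt
    rw [if_neg h1, if_neg h2, if_neg h3, not_le] at hlt
    refine hno p hp q hq r hr h1 h2 h3 (isAugmentable_of_dense (by simp) (by simp) (by simp)
      (hne _ hp _ hq h1) (hne _ hp _ hr h2) (hne _ hq _ hr h3) (hX _ hp _ hq h1)
      (hX _ hp _ hr h2) (hX _ hq _ hr h3) ha hb hc ?_)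
    rw [card_cls (hsize p hp), card_cls (hsize q hq), card_cls (hsize r hr)]
    linarith

omit [DecidableEq V] in
lemma sum_sum_erase_le (T : Finset (Finset V × Finset V × Finset V))
    (A : (Finset V × Finset V × Finset V) → Fin 3)
    {f : (Finset V × Finset V × Finset V) → Fin 3 → ℝ} {g : (Finset V × Finset V × Finset V) → ℝ}
    (h : ∀ p ∈ T, ∀ a, a ≠ A p → f p a ≤ g p) :
    ∑ p ∈ T, ∑ a ∈ Finset.univ.erase (A p), f p a ≤ 2 * ∑ p ∈ T, g p := by
  rw [Finset.mul_sum]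
  refine Finset.sum_le_sum fun p hp => ?_
  refine (Finset.sum_le_card_nsmul _ _ _ fun a ha => h p hp a (Finset.ne_of_mem_erase ha)).trans ?_
  simp [Finset.card_erase_of_mem]

lemma edgeSum_avoiding_le {H : Finset (Finset V)}
    {T : Finset (Finset V × Finset V × Finset V)} {t : ℕ}
    (hsize : ∀ p ∈ T, p.1.card = t ∧ p.2.1.card = t ∧ p.2.2.card = t)
    {I B : Finset V} {η : ℝ} (hη : 0 ≤ η) {A : (Finset V × Finset V × Finset V) → Fin 3}
    {X : Finset ((Finset V × Finset V × Finset V) × (Finset V × Finset V × Finset V))}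
    (hne : ∀ p ∈ T, ∀ q ∈ T, (p, q) ∉ X → p ≠ q)
    (hX : ∀ p ∈ T, ∀ q ∈ T, (p, q) ∉ X → LinkCenters H I η p q (A p) (A q))
    (hno : ∀ p ∈ T, ∀ q ∈ T, ∀ r ∈ T, (p, q) ∉ X → (p, r) ∉ X → (q, r) ∉ X →
      ¬ IsAugmentable H I η {p, q, r})
    (hB : B ⊆ I ∪ T.biUnion fun p => (Finset.univ.erase (A p)).biUnion (cls p)) :
    edgeSum H B B B ≤ I.card * (B.card : ℝ) ^ 2 + 2 * (T.card * t) * I.card * B.card +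
      4 * (T.card * t : ℝ) ^ 2 * I.card +
      8 * (t : ℝ) ^ 3 * (2 * η * (T.card : ℝ) ^ 3 + 3 * T.card * X.card) := by
  have hthree : ∀ p ∈ T, ∀ a, a ≠ A p → ∀ q ∈ T, ∀ b, b ≠ A q →
      edgeSum H B (cls p a) (cls q b) ≤ I.card * (t : ℝ) ^ 2 + 2 * ∑ r ∈ T, (t : ℝ) ^ 3 * (2 * η +
        (if (r, p) ∈ X then 1 else 0) + (if (r, q) ∈ X then 1 else 0) +
        (if (p, q) ∈ X then 1 else 0)) := by
    intro p hp a ha q hq b hb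
    refine (edgeSum_le_sum_cls H T (fun p => Finset.univ.erase (A p)) hB _ _).trans
      (add_le_add ?_ (sum_sum_erase_le T A fun r hr c hc => ?_))
    · refine (edgeSum_le _ _ _ _).trans_eq ?_
      rw [card_cls (hsize p hp), card_cls (hsize q hq)]
      ring
    · exact edgeSum_cls_le_of_not_isAugmentable hsize hη hne hX hno hr hp hq hc ha hb
  have htwo : ∀ p ∈ T, ∀ a, a ≠ A p → edgeSum H B B (cls p a) ≤ I.card * B.card * t +
      2 * ∑ q ∈ T, (I.card * (t : ℝ) ^ 2 + 2 * ∑ r ∈ T, (t : ℝ) ^ 3 * (2 * η +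
        (if (r, p) ∈ X then 1 else 0) + (if (r, q) ∈ X then 1 else 0) +
        (if (p, q) ∈ X then 1 else 0))) := by
    intro p hp a ha
    refine (edgeSum_le_sum_cls H T (fun p => Finset.univ.erase (A p)) hB _ _).trans
      (add_le_add ?_ (sum_sum_erase_le T A fun q hq b hb => ?_))
    · refine (edgeSum_le _ _ _ _).trans_eq ?_
      rw [card_cls (hsize p hp)]
    · rw [edgeSum_rotate]
      exact hthree p hp a ha q hq b hb
  have hone : edgeSum H B B B ≤ I.card * B.card * B.card + 2 * ∑ p ∈ T, ((I.card * B.card * t : ℝ) +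
      2 * ∑ q ∈ T, (I.card * (t : ℝ) ^ 2 + 2 * ∑ r ∈ T, (t : ℝ) ^ 3 * (2 * η +
        (if (r, p) ∈ X then 1 else 0) + (if (r, q) ∈ X then 1 else 0) +
        (if (p, q) ∈ X then 1 else 0)))) := by
    refine (edgeSum_le_sum_cls H T (fun p => Finset.univ.erase (A p)) hB _ _).trans
      (add_le_add (edgeSum_le _ _ _ _) (sum_sum_erase_le T A fun p hp a ha => ?_))
    rw [edgeSum_rotate]
    exact htwo p hp a ha
  refine hone.trans ?_
  have hS := sum_indicator_le T X
  have hS' := hS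
  rw [Finset.sum_comm] at hS'
  simp only [Finset.sum_add_distrib, ← Finset.mul_sum, Finset.sum_const, nsmul_eq_mul]
  have hS3 : ∑ p ∈ T, ∑ q ∈ T, ∑ r ∈ T, (if (r, q) ∈ X then (1 : ℝ) else 0) ≤ T.card * X.card := by
    rw [Finset.sum_const, nsmul_eq_mul]
    gcongr
  have ht : (0 : ℝ) ≤ (t : ℝ) ^ 3 := by positivity
  have hm : (0 : ℝ) ≤ T.card := by positivity
  have hfin := mul_le_mul_of_nonneg_left (add_le_add (add_le_add
    (mul_le_mul_of_nonneg_left hS' hm) (mul_le_mul_of_nonneg_left hS' hm))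
    (mul_le_mul_of_nonneg_left hS hm)) ht
  linarith

/-- The vertices outside the central classes span few edges. -/
lemma exists_extremal_set [Fintype V] {H : Finset (Finset V)} (hH : ∀ e ∈ H, e.card = 3)
    {T : Finset (Finset V × Finset V × Finset V)} (hT : IsTriCover H T) {t : ℕ}
    (hsize : ∀ p ∈ T, p.1.card = t ∧ p.2.1.card = t ∧ p.2.2.card = t)
    {I : Finset V} (hI : I = Finset.univ \ coverVerts T) {s α : ℝ} (hs : 0 < s) (hs' : s ≤ 1 / 60)
    (hα : 5000 * s < α) (hn : 12 ≤ Fintype.card V)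
    (hIcard : (I.card : ℝ) ≤ 25 * s * Fintype.card V)
    {A : (Finset V × Finset V × Finset V) → Fin 3}
    {X : Finset ((Finset V × Finset V × Finset V) × (Finset V × Finset V × Finset V))}
    (hXcard : (X.card : ℝ) ≤ 9 * s * (T.card : ℝ) ^ 2)
    (hne : ∀ p ∈ T, ∀ q ∈ T, (p, q) ∉ X → p ≠ q)
    (hX : ∀ p ∈ T, ∀ q ∈ T, (p, q) ∉ X → LinkCenters H I (s ^ 2) p q (A p) (A q))
    (hno : ∀ p ∈ T, ∀ q ∈ T, ∀ r ∈ T, (p, q) ∉ X → (p, r) ∉ X → (q, r) ∉ X →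
      ¬ IsAugmentable H I (s ^ 2) {p, q, r}) :
    ∃ B : Finset V, (2 / 3 - α) * Fintype.card V ≤ (B.card : ℝ) ∧
      ((H.filter fun e => e ⊆ B).card : ℝ) < α * (B.card.choose 3 : ℝ) := by
  set B : Finset V := Finset.univ \ T.biUnion fun p => cls p (A p) with hBdef
  have hBsub : B ⊆ I ∪ T.biUnion fun p => (Finset.univ.erase (A p)).biUnion (cls p) := by
    intro v hv
    have hv' : ∀ p ∈ T, v ∉ cls p (A p) := by
      intro p hp hvp
      exact (Finset.mem_sdiff.1 hv).2 (Finset.mem_biUnion.2 ⟨p, hp, hvp⟩)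
    by_cases hvc : v ∈ coverVerts T
    · obtain ⟨p, hp, hvp⟩ := Finset.mem_biUnion.1 hvc
      obtain ⟨a, ha⟩ := mem_triVerts_iff.1 hvp
      refine Finset.mem_union_right _ (Finset.mem_biUnion.2 ⟨p, hp, Finset.mem_biUnion.2
        ⟨a, Finset.mem_erase.2 ⟨?_, Finset.mem_univ a⟩, ha⟩⟩)
      rintro rfl
      exact hv' p hp ha
    · exact Finset.mem_union_left _ (by simp [hI, hvc])
  have hcov : 3 * (T.card * t : ℝ) ≤ Fintype.card V := by
    have h1 : (coverVerts T).card = T.card * (3 * t) := hT.card_biUnion_triVerts hsize subset_rfl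
    have h2 := Finset.card_le_univ (coverVerts T)
    rw [h1] at h2
    have h3 : ((T.card * (3 * t) : ℕ) : ℝ) ≤ Fintype.card V := Nat.cast_le.2 h2
    push_cast at h3
    linarith
  have hBcard : (Fintype.card V : ℝ) - T.card * t ≤ B.card := by
    have h1 : (T.biUnion fun p => cls p (A p)).card ≤ T.card * t :=
      Finset.card_biUnion_le_card_mul _ _ _ fun p hp => (card_cls (hsize p hp) _).le
    have h2 := Finset.card_sdiff_add_card_eq_card
      (Finset.subset_univ (T.biUnion fun p => cls p (A p)))
    rw [← hBdef, Finset.card_univ] at h2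
    have h3 : (Fintype.card V : ℝ) ≤ B.card + T.card * t := by
      rw [← h2]
      push_cast
      gcongr
      exact_mod_cast h1
    linarith
  have hBn : (B.card : ℝ) ≤ Fintype.card V := Nat.cast_le.2 (Finset.card_le_univ B)
  have hn' : (12 : ℝ) ≤ Fintype.card V := by exact_mod_cast hn
  have hn0 : (0 : ℝ) < Fintype.card V := by linarith
  refine ⟨B, ?_, ?_⟩
  · have : 0 ≤ α * Fintype.card V := by
      have : 0 < α := by linarith
      positivity
    linarith
  have hlow : (Fintype.card V : ℝ) ^ 3 / 48 ≤ (B.card.choose 3 : ℝ) := by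
    have h1 := Nat.pow_le_choose (α := ℝ) 3 B.card
    have h2 : (Fintype.card V : ℝ) / 2 ≤ ((B.card - 2 : ℕ) : ℝ) := by
      have h3 : B.card ≤ (B.card - 2) + 2 := by omega
      have h4 : (B.card : ℝ) ≤ ((B.card - 2 : ℕ) : ℝ) + 2 := by exact_mod_cast h3
      linarith
    have h5 : ((Fintype.card V : ℝ) / 2) ^ 3 ≤ ((B.card - 2 : ℕ) : ℝ) ^ 3 := by gcongr
    simp only [Nat.factorial] at h1
    push_cast at h1
    linarith
  have hup := (card_filter_subset_le_edgeSum hH B).trans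
    (edgeSum_avoiding_le hsize (sq_nonneg s) hne hX hno hBsub)
  have hw0 : (0 : ℝ) ≤ I.card := by positivity
  have hb0 : (0 : ℝ) ≤ B.card := by positivity
  have hu0 : (0 : ℝ) ≤ T.card * t := by positivity
  have hXt : (t : ℝ) ^ 3 * (T.card * X.card) ≤ 9 * s * (T.card * t : ℝ) ^ 3 := by
    have := mul_le_mul_of_nonneg_left hXcard (show (0 : ℝ) ≤ (t : ℝ) ^ 3 * T.card by positivity)
    linarith
  generalize (Fintype.card V : ℝ) = n at *
  generalize (I.card : ℝ) = w at *
  generalize (B.card : ℝ) = b at *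
  have hup' : ((H.filter fun e => e ⊆ B).card : ℝ) ≤ w * b ^ 2 + 2 * (T.card * t) * w * b +
      4 * (T.card * t : ℝ) ^ 2 * w + (16 * s ^ 2 + 216 * s) * (T.card * t : ℝ) ^ 3 := by
    linarith
  generalize (T.card * t : ℝ) = u at *
  have hu : u ≤ n / 3 := by linarith
  have h1 : w * b ^ 2 + 2 * u * w * b + 4 * u ^ 2 * w + (16 * s ^ 2 + 216 * s) * u ^ 3 ≤
      25 * s * n * n ^ 2 + 2 * (n / 3) * (25 * s * n) * n + 4 * (n / 3) ^ 2 * (25 * s * n) +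
        (16 * s ^ 2 + 216 * s) * (n / 3) ^ 3 := by gcongr
  have hn3 : 0 < n ^ 3 := by positivity
  have h2 : s ^ 2 * n ^ 3 ≤ s / 60 * n ^ 3 := by
    refine mul_le_mul_of_nonneg_right ?_ hn3.le
    have := mul_le_mul_of_nonneg_left hs' hs.le
    linarith
  have h3 : 5000 * s * (n ^ 3 / 48) < α * (n ^ 3 / 48) := by gcongr
  have h4 : α * (n ^ 3 / 48) ≤ α * (B.card.choose 3 : ℝ) :=
    mul_le_mul_of_nonneg_left hlow (by linarith)
  have h5 : 0 < s * n ^ 3 := by positivity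
  linarith

end ExtremalSet

section Main

lemma exists_maximal_pairwiseDisjoint {α : Type*} [DecidableEq α] (F : Finset (Finset α)) :
    ∃ G ⊆ F, (G : Set (Finset α)).PairwiseDisjoint id ∧
      ∀ P ∈ F, P.Nonempty → ¬ Disjoint P (G.biUnion id) := by
  obtain ⟨G, hG, hmax⟩ := Finset.exists_max_image
    (F.powerset.filter fun G : Finset (Finset α) => (G : Set (Finset α)).PairwiseDisjoint id)
    Finset.card
    ⟨∅, by simp⟩
  obtain ⟨hGF, hGd⟩ := Finset.mem_filter.1 hG
  rw [Finset.mem_powerset] at hGF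
  refine ⟨G, hGF, hGd, fun P hP hne hdisj => ?_⟩
  rw [Finset.disjoint_biUnion_right] at hdisj
  have hPG : P ∉ G := fun h => hne.ne_empty (disjoint_self.1 (hdisj P h))
  have h := hmax (insert P G) (Finset.mem_filter.2 ⟨Finset.mem_powerset.2
    (Finset.insert_subset hP hGF), ?_⟩)
  · rw [Finset.card_insert_of_notMem hPG] at h
    omega
  · rw [Finset.coe_insert]
    exact hGd.insert fun Q hQ _ => hdisj Q hQ

lemma card_filter_not_pair_le {α : Type*} [DecidableEq α] (T W : Finset α) (L : α → α → Prop)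
    {s : ℝ} (hs : 0 ≤ s)
    (hL : 2 * (1 - 2 * s) * (T.card.choose 2 : ℝ) ≤
      ((T.offDiag.filter fun pq => L pq.1 pq.2).card : ℝ)) :
    (((T ×ˢ T).filter fun pq => ¬ (pq.1 ≠ pq.2 ∧ pq.1 ∉ W ∧ pq.2 ∉ W ∧ L pq.1 pq.2)).card : ℝ) ≤
      T.card + 2 * W.card * T.card + 2 * s * (T.card : ℝ) ^ 2 := by
  have hsub : ((T ×ˢ T).filter fun pq => ¬ (pq.1 ≠ pq.2 ∧ pq.1 ∉ W ∧ pq.2 ∉ W ∧ L pq.1 pq.2)) ⊆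
      (T.diag ∪ (W ×ˢ T ∪ T ×ˢ W)) ∪ (T.offDiag.filter fun pq => ¬ L pq.1 pq.2) := by
    rintro ⟨p, q⟩ h
    simp only [Finset.mem_filter, Finset.mem_product, Finset.mem_union, Finset.mem_diag,
      Finset.mem_offDiag] at h ⊢
    tauto
  have h1 := (Finset.card_le_card hsub).trans ((Finset.card_union_le _ _).trans
    (Nat.add_le_add_right ((Finset.card_union_le _ _).trans
      (Nat.add_le_add_left (Finset.card_union_le _ _) _)) _))
  rw [Finset.card_product, Finset.card_product, Finset.diag_card] at h1
  have h2 := Finset.card_filter_add_card_filter_not (s := T.offDiag) fun pq => L pq.1 pq.2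
  have h3 : T.offDiag.card + T.card = T.card * T.card := by
    rw [Finset.offDiag_card]
    exact Nat.sub_add_cancel (Nat.le_mul_self _)
  rw [← h2] at h3
  have h1' := (Nat.cast_le (α := ℝ)).2 h1
  have h3' := congrArg (Nat.cast (R := ℝ)) h3
  push_cast at h1' h3'
  rw [Nat.cast_choose_two] at hL
  have h4 : 0 ≤ 2 * s * (T.card : ℝ) := by positivity
  linarith

lemma sq_floor_le {η n : ℝ} (hη : 0 < η) (hη' : η ≤ 1 / 4) (hn : 0 < n) :
    (⌊η * Real.sqrt (Real.logb 2 (η ^ 2 * n))⌋₊ : ℝ) ^ 2 ≤ n := by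
  have h1 : (⌊η * Real.sqrt (Real.logb 2 (η ^ 2 * n))⌋₊ : ℝ) ≤
      η * Real.sqrt (Real.logb 2 (η ^ 2 * n)) := Nat.floor_le (by positivity)
  have hx : 0 < η ^ 2 * n := by positivity
  have h2 : Real.logb 2 (η ^ 2 * n) ≤ 2 * n := by
    have h3 := Real.log_le_self hx.le
    have h4 := Real.log_two_gt_d9
    rw [Real.logb, div_le_iff₀ (by linarith)]
    have h5 : η ^ 2 * n ≤ 1 * n := by
      gcongr
      nlinarith
    nlinarith
  calc (⌊η * Real.sqrt (Real.logb 2 (η ^ 2 * n))⌋₊ : ℝ) ^ 2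
      ≤ (η * Real.sqrt (Real.logb 2 (η ^ 2 * n))) ^ 2 := by gcongr
    _ = η ^ 2 * max (Real.logb 2 (η ^ 2 * n)) 0 := by rw [mul_pow, Real.sq_sqrt']
    _ ≤ (1 / 4) ^ 2 * (2 * n) := by
      gcongr
      exact max_le h2 (by positivity)
    _ ≤ n := by linarith

lemma sqrt_le_of_sq_le {n : ℝ} {m t : ℕ} (hn : 0 < n) (ht : (t : ℝ) ^ 2 ≤ n)
    (hv : n ≤ 6 * (m * t)) : Real.sqrt n ≤ 6 * m := by
  have hR : 0 < Real.sqrt n := Real.sqrt_pos.2 hn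
  have htR : (t : ℝ) ≤ Real.sqrt n := Real.le_sqrt_of_sq_le ht
  refine le_of_mul_le_mul_right ?_ hR
  rw [Real.mul_self_sqrt hn.le]
  refine hv.trans ?_
  rw [← mul_assoc]
  gcongr

lemma exists_parameters {η n w : ℝ} {m t : ℕ} (hη : 0 < η) (hη' : η ≤ 1 / 4) (hn : 0 < n)
    (hR : 1000 ≤ η ^ 3 * Real.sqrt n) (ht : 0 < t) (ht2 : (t : ℝ) ^ 2 ≤ n)
    (hv : n ≤ 6 * (m * t)) (hw : η ^ 2 * n ≤ w) :
    ∃ l k : ℕ, l ≤ t ∧ (l : ℝ) - 1 < 2 * η / 3 * t ∧ η ^ 4 * n ≤ 3 * (k * l) ∧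
      4 * (k : ℝ) * l < 2 * η / 3 * w ∧ ∀ g : ℕ, g < k → (g : ℝ) ≤ 4 * η ^ 3 * m := by
  have ht' : (0 : ℝ) < t := Nat.cast_pos.2 ht
  have hηt : 0 < η * t := by positivity
  have hlt : ⌈η * t / 2⌉₊ ≤ t := Nat.ceil_le.2 (by nlinarith)
  have hl0 : (0 : ℝ) < ⌈η * t / 2⌉₊ := Nat.cast_pos.2 (Nat.ceil_pos.2 (by positivity))
  have hl1 : (⌈η * t / 2⌉₊ : ℝ) < η * t / 2 + 1 := Nat.ceil_lt_add_one (by positivity)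
  have hl2 : η * t / 2 ≤ (⌈η * t / 2⌉₊ : ℝ) := Nat.le_ceil _
  have hltR : (⌈η * t / 2⌉₊ : ℝ) ≤ t := Nat.cast_le.2 hlt
  generalize ⌈η * t / 2⌉₊ = l at *
  have hk1 : η ^ 4 * n / (3 * l) ≤ (⌈η ^ 4 * n / (3 * l)⌉₊ : ℝ) := Nat.le_ceil _
  have hk2 : (⌈η ^ 4 * n / (3 * l)⌉₊ : ℝ) < η ^ 4 * n / (3 * l) + 1 :=
    Nat.ceil_lt_add_one (by positivity)
  refine ⟨l, ⌈η ^ 4 * n / (3 * l)⌉₊, hlt, by linarith, ?_, ?_, ?_⟩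
  · rw [div_le_iff₀ (by positivity)] at hk1
    linarith
  · have h1 : (⌈η ^ 4 * n / (3 * l)⌉₊ : ℝ) * l < (η ^ 4 * n / (3 * l) + 1) * l := by gcongr
    have h2 : (η ^ 4 * n / (3 * l) + 1) * l = η ^ 4 * n / 3 + l := by field_simp
    have h3 : 2 * η / 3 * (η ^ 2 * n) ≤ 2 * η / 3 * w := by gcongr
    have h4 : η ^ 3 * n * η ≤ η ^ 3 * n * (1 / 4) := by gcongr
    have hR0 : 0 < Real.sqrt n := Real.sqrt_pos.2 hn
    have htR : (t : ℝ) ≤ Real.sqrt n := Real.le_sqrt_of_sq_le ht2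
    have h5 := mul_le_mul_of_nonneg_right hR hR0.le
    rw [mul_assoc, Real.mul_self_sqrt hn.le] at h5
    linarith
  · intro g hg
    rw [Nat.lt_ceil, lt_div_iff₀ (by positivity)] at hg
    have h1 : (g : ℝ) * (3 * (η * t / 2)) ≤ g * (3 * l) := by gcongr
    have h2 : η ^ 4 * n ≤ η ^ 4 * (6 * (m * t)) := by gcongr
    refine le_of_mul_le_mul_right ?_ hηt
    linarith

lemma error_terms_le {s m g : ℝ} (hs : 0 < s) (hs' : s ≤ 1 / 60) (hm : 0 ≤ m) (hsm : 2 ≤ s * m)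
    (hg : g ≤ 12 * (s ^ 2) ^ 3 * m) : m + 2 * g * m + 2 * s * m ^ 2 ≤ 3 * s * m ^ 2 := by
  have h1 : g * m ≤ 12 * (s ^ 2) ^ 3 * m * m := by gcongr
  have h2 : s ^ 5 ≤ (1 / 60) ^ 5 := by gcongr
  have h3 : s ^ 5 * (s * m ^ 2) ≤ (1 / 60) ^ 5 * (s * m ^ 2) := by gcongr
  have h4 : 2 * m ≤ s * m * m := by gcongr
  have h5 : 0 ≤ s * m ^ 2 := by positivity
  linarith

end Main

/-- Claim: if at most `η·|V(T)|` vertices lie in at least 2-sided members and for at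
least `(1 − 2√η)·C(|T|,2)` unordered pairs (equivalently `2(1 − 2√η)·C(|T|,2)` ordered
pairs) the link graph is isomorphic to `B₃₁₁`, then either the cover can be enlarged by
at least `η⁴n` vertices (keeping members balanced of one size), or `H` is `α`-extremal. -/
theorem stmt13 :
    ∃ α₀ : ℝ, 0 < α₀ ∧ ∀ α : ℝ, 0 < α → α < α₀ →
    ∃ η₀ : ℝ, 0 < η₀ ∧ ∀ η : ℝ, 0 < η → η < η₀ →
    ∃ n₀ : ℕ, ∀ n : ℕ, n₀ ≤ n →
    ∀ (V : Type) [Fintype V] [DecidableEq V], Fintype.card V = n →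
    ∀ H : Finset (Finset V), (∀ e ∈ H, e.card = 3) →
    (∀ v : V, (5 / 9 - 10 * η) * (n.choose 2 : ℝ) ≤ ((H.filter fun e => v ∈ e).card : ℝ)) →
    ∀ T : Finset (Finset V × Finset V × Finset V), IsTriCover H T →
    ∀ t : ℕ, t = ⌊η * Real.sqrt (Real.logb 2 (η ^ 2 * n))⌋₊ →
    (∀ p ∈ T, p.1.card = t ∧ p.2.1.card = t ∧ p.2.2.card = t) →
    (n : ℝ) / 2 ≤ ((coverVerts T).card : ℝ) →
    ∀ I : Finset V, I = Finset.univ \ coverVerts T →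
    η ^ 2 * n ≤ (I.card : ℝ) →
    ((H.filter fun e => e ⊆ I).card : ℝ) < η * (I.card.choose 3 : ℝ) →
    (((T.filter fun p => TwoSided H I η p).biUnion triVerts).card : ℝ) ≤
      η * ((coverVerts T).card : ℝ) →
    2 * (1 - 2 * Real.sqrt η) * (T.card.choose 2 : ℝ) ≤
      ((T.offDiag.filter fun pq => LinkB311 H I η pq.1 pq.2).card : ℝ) →
    (∃ T' : Finset (Finset V × Finset V × Finset V), IsTriCover H T' ∧
        (∃ t' : ℕ, ∀ p ∈ T', p.1.card = t' ∧ p.2.1.card = t' ∧ p.2.2.card = t') ∧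
        ((coverVerts T).card : ℝ) + η ^ 4 * n ≤ ((coverVerts T').card : ℝ)) ∨
    (∃ B : Finset V, (2 / 3 - α) * n ≤ (B.card : ℝ) ∧
        ((H.filter fun e => e ⊆ B).card : ℝ) < α * (B.card.choose 3 : ℝ)) := by
  refine ⟨1, one_pos, fun α hα hα1 => ⟨(α / 5000) ^ 2, by positivity, fun η hη hηα =>
    ⟨⌈(1000 / η ^ 3) ^ 2⌉₊, ?_⟩⟩⟩
  rintro n hn V _ _ rfl H hH hdeg T hT t ht hsize hcov I hI hIcard hsparse htwo hlink
  set s := Real.sqrt η with hs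
  have hs0 : 0 < s := Real.sqrt_pos.2 hη
  have hsα : 5000 * s < α := by
    have : s < α / 5000 := (Real.sqrt_lt' (by positivity)).2 hηα
    linarith
  have hs1 : s ≤ 1 / 60 := by linarith
  have hs2 : s ^ 2 = η := Real.sq_sqrt hη.le
  have hη' : η ≤ 1 / 4 := by nlinarith
  have hR : 1000 ≤ η ^ 3 * Real.sqrt (Fintype.card V) := by
    have h := Real.le_sqrt_of_sq_le (Nat.ceil_le.1 hn)
    rw [div_le_iff₀ (by positivity)] at h
    linarith
  have hη3 : η ^ 3 ≤ 1 := pow_le_one₀ hη.le (by linarith)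
  have hR0 : 0 ≤ Real.sqrt (Fintype.card V) := Real.sqrt_nonneg _
  have hR1 : 1000 ≤ Real.sqrt (Fintype.card V) := by nlinarith
  have hsR : 1000 ≤ s * Real.sqrt (Fintype.card V) := by
    have : η ^ 3 ≤ s := by
      rw [← hs2, ← pow_mul]
      exact pow_le_of_le_one hs0.le (by linarith) (by norm_num)
    nlinarith
  have hRn : Real.sqrt (Fintype.card V) * Real.sqrt (Fintype.card V) = Fintype.card V :=
    Real.mul_self_sqrt (Nat.cast_nonneg _)
  have hn1 : 1 ≤ s * Fintype.card V := by
    rw [← hRn]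
    nlinarith
  have hn12 : (12 : ℝ) ≤ Fintype.card V := by
    rw [← hRn]
    nlinarith
  have hn0 : (0 : ℝ) < Fintype.card V := by linarith
  have hcovcard : (coverVerts T).card = T.card * (3 * t) :=
    hT.card_biUnion_triVerts hsize subset_rfl
  have hcov' : (Fintype.card V : ℝ) ≤ 6 * (T.card * t) := by
    rw [hcovcard] at hcov
    push_cast at hcov
    linarith
  have hmt : 0 < T.card * t := by
    have : (0 : ℝ) < ((T.card * t : ℕ) : ℝ) := by
      push_cast
      linarith
    exact_mod_cast this
  have ht0 : 0 < t := Nat.pos_of_mul_pos_left hmt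
  have hTne : T.Nonempty := Finset.card_pos.1 (Nat.pos_of_mul_pos_right hmt)
  have ht2 : (t : ℝ) ^ 2 ≤ Fintype.card V := ht ▸ sq_floor_le hη hη' hn0
  have hsm : 2 ≤ s * T.card := by
    have := mul_le_mul_of_nonneg_left (sqrt_le_of_sq_le hn0 ht2 hcov') hs0.le
    linarith
  have hdisj : Disjoint I (coverVerts T) := hI ▸ Finset.sdiff_disjoint
  obtain ⟨l, k, hlt, hl, hkl, hkl', hg⟩ := exists_parameters hη hη' hn0 hR ht0 ht2 hcov' hIcard
  obtain ⟨G, hGF, hGd, hGmax⟩ := exists_maximal_pairwiseDisjoint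
    ((T.powersetCard 3).filter fun P => IsAugmentable H I η P)
  have hGaug : ∀ P ∈ G, P ⊆ T ∧ P.card = 3 ∧ IsAugmentable H I η P := by
    intro P hP
    obtain ⟨h1, h2⟩ := Finset.mem_filter.1 (hGF hP)
    obtain ⟨h3, h4⟩ := Finset.mem_powersetCard.1 h1
    exact ⟨h3, h4, h2⟩
  rcases le_or_gt k G.card with hkG | hkG
  · left
    obtain ⟨G', hG', rfl⟩ := Finset.exists_subset_card_eq hkG
    obtain ⟨T', hT', hT'1, hT'card⟩ := exists_larger_cover hT hsize hdisj hη hlt hl G'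
      (fun P hP => hGaug P (hG' hP)) (hGd.subset (Finset.coe_subset.2 hG')) hkl'
    refine ⟨T', hT', ⟨1, hT'1⟩, ?_⟩
    rw [hT'card, hcovcard]
    push_cast
    linarith
  right
  set W := G.biUnion id with hW
  have hWcard : (W.card : ℝ) ≤ 12 * (s ^ 2) ^ 3 * T.card := by
    have h1 : W.card ≤ G.card * 3 :=
      Finset.card_biUnion_le_card_mul _ _ _ fun P hP => (hGaug P hP).2.1.le
    have h2 : (W.card : ℝ) ≤ G.card * 3 := by exact_mod_cast h1
    rw [hs2]
    linarith [hg _ hkG]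
  set Good : (Finset V × Finset V × Finset V) → (Finset V × Finset V × Finset V) → Prop :=
    fun p q => p ∈ T ∧ q ∈ T ∧ p ≠ q ∧ p ∉ W ∧ q ∉ W ∧ ∃ a c, LinkCenters H I η p q a c
    with hGood
  have hno : ∀ p q r, Good p q → Good p r → Good q r → ¬ IsAugmentable H I η {p, q, r} := by
    intro p q r h1 h2 h3 haug
    refine hGmax {p, q, r} (Finset.mem_filter.2 ⟨Finset.mem_powersetCard.2 ⟨?_, ?_⟩, haug⟩)
      (Finset.insert_nonempty _ _) ?_
    · simp [Finset.insert_subset_iff, h1.1, h1.2.1, h2.2.1]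
    · exact Finset.card_eq_three.2 ⟨p, q, r, h1.2.2.1, h2.2.2.1, h3.2.2.1, rfl⟩
    · simp only [Finset.disjoint_insert_left, Finset.disjoint_singleton_left]
      exact ⟨h1.2.2.2.1, h1.2.2.2.2.1, h2.2.2.2.2.1⟩
  have hbad : (((T ×ˢ T).filter fun pq => ¬ Good pq.1 pq.2).card : ℝ) ≤
      3 * s * (T.card : ℝ) ^ 2 := by
    refine le_trans ?_ ((card_filter_not_pair_le T W (LinkB311 H I η) hs0.le hlink).trans
      (error_terms_le hs0 hs1 (Nat.cast_nonneg _) hsm hWcard))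
    refine Nat.cast_le.2 (Finset.card_le_card fun pq hpq => ?_)
    rw [Finset.mem_filter] at hpq ⊢
    obtain ⟨hp, hq⟩ := Finset.mem_product.1 hpq.1
    exact ⟨hpq.1, fun h => hpq.2 ⟨hp, hq, h.1, h.2.1, h.2.2.1, h.2.2.2.exists_linkCenters⟩⟩
  obtain ⟨A, X, hXcard, hX⟩ := exists_common_centers hTne Good
    (fun p q ⟨h1, h2, h3, h4, h5, a, c, h6⟩ => ⟨h2, h1, h3.symm, h5, h4, c, a, h6.symm⟩)
    (fun p q h => h.2.2.1) (fun p q h => h.2.2.2.2.2) hno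
  have hXcard' : (X.card : ℝ) ≤ 9 * s * (T.card : ℝ) ^ 2 := by
    refine (Nat.cast_le.2 hXcard).trans ?_
    push_cast
    linarith
  clear_value s
  subst hs2
  exact exists_extremal_set hH hT hsize hI hs0 hs1 hsα (by exact_mod_cast hn12)
    (card_uncovered_le hH hT hsize ht0 hI hs0.le hs1 hn1 hdeg hsparse.le htwo hXcard'
      fun p hp q hq h => (hX p hp q hq h).2)
    hXcard' (fun p hp q hq h => (hX p hp q hq h).1.2.2.1)
    (fun p hp q hq h => (hX p hp q hq h).2)
    fun p hp q hq r hr h1 h2 h3 => hno p q r (hX p hp q hq h1).1 (hX p hp r hr h2).1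
      (hX q hq r hr h3).1
end

section
/- There exist α₀ > 0 and n₀ such that for every α ∈ (0, α₀) and every n ≥ n₀ divisible by 3 the following holds. Let H be a 3-graph on an n-element vertex set V with δ₁(H) ≥ C(n−1,2) − C(2n/3,2) + 1, and suppose there is a partition V = A ∪ B with |A| = n/3, |B| = 2n/3 and e(H|_B) < 6α·C(2n/3,3). Then there exist a partition V = Ā ∪ B̄ with |Ā| = n/3, |B̄| = 2n/3 and e(H|_B̄) < 6α·C(2n/3,3), and a matching M in H, such that M covers every vertex of S_Ā ∪ S_B̄, where S_Ā = { a ∈ Ā : deg(a, C(B̄,2)) < α^(1/3)·C(2n/3,2) } and S_B̄ = { b ∈ B̄ : deg(b, B̄×Ā) < α^(1/3)·(n/3)·(2n/3 − 1) }, and such that |B̄ ∖ V(M)| = 2·|Ā ∖ V(M)| = (2/3)·(n − |V(M)|). -/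
attribute [local instance] Classical.propDecidable

/-- `deg(a, C(B,2))`: the number of 2-element subsets `{b,b'}` of `B` with
`{a,b,b'} ∈ H`. -/
def degA {V : Type} [DecidableEq V] (H : Finset (Finset V)) (B : Finset V) (a : V) : ℕ :=
  ((B.powersetCard 2).filter fun p => insert a p ∈ H).card

/-- `deg(b, B×A)`: the number of pairs `(b', a)` with `b' ∈ B ∖ {b}`, `a ∈ A` and
`{b,b',a} ∈ H`. -/
def degB {V : Type} [DecidableEq V] (H : Finset (Finset V)) (A B : Finset V) (b : V) : ℕ :=
  (((B.erase b) ×ˢ A).filter fun q => ({b, q.1, q.2} : Finset V) ∈ H).card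

theorem degA_eq_card_filter {V : Type} [DecidableEq V] {H : Finset (Finset V)}
    (hH : ∀ e ∈ H, e.card = 3) {C : Finset V} {v : V} (hv : v ∉ C) :
    degA H C v = (H.filter fun e => e ⊆ insert v C ∧ v ∈ e).card := by
  unfold degA
  refine Finset.card_nbij' (fun p => insert v p) (fun e => e.erase v) ?_ ?_ ?_ ?_
  · intro p hp
    simp only [Finset.coe_filter, Finset.mem_powersetCard, Set.mem_ofPred_eq] at hp ⊢
    exact ⟨hp.2, Finset.insert_subset_insert _ hp.1.1, Finset.mem_insert_self _ _⟩
  · intro e he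
    simp only [Finset.coe_filter, Finset.mem_powersetCard, Set.mem_ofPred_eq] at he ⊢
    refine ⟨⟨?_, ?_⟩, ?_⟩
    · intro x hx
      have := he.2.1 (Finset.mem_of_mem_erase hx)
      exact (Finset.mem_insert.1 this).resolve_left (Finset.ne_of_mem_erase hx)
    · rw [Finset.card_erase_of_mem he.2.2, hH e he.1]
    · rw [Finset.insert_erase he.2.2]; exact he.1
  · intro p hp
    simp only [Finset.coe_filter, Finset.mem_powersetCard, Set.mem_ofPred_eq] at hp
    exact Finset.erase_insert fun h => hv (hp.1.1 h)
  · intro e he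
    simp only [Finset.coe_filter, Set.mem_ofPred_eq] at he
    exact Finset.insert_erase he.2.2

theorem card_filter_subset_insert {V : Type} [DecidableEq V] {H : Finset (Finset V)}
    (hH : ∀ e ∈ H, e.card = 3) {C : Finset V} {v : V} (hv : v ∉ C) :
    (H.filter fun e => e ⊆ insert v C).card =
      (H.filter fun e => e ⊆ C).card + degA H C v := by
  rw [degA_eq_card_filter hH hv,
    ← Finset.card_filter_add_card_filter_not (s := H.filter fun e => e ⊆ insert v C)
      (fun e => v ∈ e), add_comm, Finset.filter_filter, Finset.filter_filter]
  congr 2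
  ext e
  simp only [Finset.mem_filter, and_congr_right_iff]
  intro _
  constructor
  · rintro ⟨h1, h2⟩
    exact (Finset.subset_insert_iff_of_notMem h2).1 h1
  · exact fun h => ⟨h.trans (Finset.subset_insert _ _), fun h' => hv (h h')⟩

theorem sum_card_filter_mem {V : Type} [DecidableEq V] (B : Finset V)
    (F : Finset (Finset V)) :
    ∑ b ∈ B, (F.filter fun e => b ∈ e).card = ∑ e ∈ F, (B.filter fun b => b ∈ e).card :=
  (Finset.sum_card_bipartiteAbove_eq_sum_card_bipartiteBelow
    (fun (e : Finset V) b => b ∈ e)).symm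

theorem sum_degA_erase {V : Type} [DecidableEq V] {H : Finset (Finset V)}
    (hH : ∀ e ∈ H, e.card = 3) (B : Finset V) :
    ∑ b ∈ B, degA H (B.erase b) b = 3 * (H.filter fun e => e ⊆ B).card := by
  have h1 : ∀ b ∈ B, degA H (B.erase b) b =
      ((H.filter fun e => e ⊆ B).filter fun e => b ∈ e).card := by
    intro b hb
    rw [degA_eq_card_filter hH (Finset.notMem_erase b B), Finset.insert_erase hb,
      Finset.filter_filter]
  rw [Finset.sum_congr rfl h1, sum_card_filter_mem, mul_comm, ← smul_eq_mul]
  refine Finset.sum_eq_card_nsmul fun e he => ?_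
  rw [Finset.mem_filter] at he
  rw [← hH e he.1]
  congr 1
  ext x
  simp only [Finset.mem_filter]
  exact ⟨fun h => h.2, fun h => ⟨he.2 h, h⟩⟩

theorem degA_mono {V : Type} [DecidableEq V] (H : Finset (Finset V)) {C D : Finset V}
    (h : C ⊆ D) (v : V) : degA H C v ≤ degA H D v :=
  Finset.card_le_card (Finset.filter_subset_filter _ (Finset.powersetCard_mono h))

theorem degA_le_choose {V : Type} [DecidableEq V] (H : Finset (Finset V)) (C : Finset V)
    (v : V) : degA H C v ≤ C.card.choose 2 :=
  (Finset.card_filter_le _ _).trans (Finset.card_powersetCard 2 C).le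

theorem sum_degB_le {V : Type} [DecidableEq V] (H : Finset (Finset V)) (A B : Finset V) :
    ∑ b ∈ B, degB H A B b ≤ 2 * ∑ a ∈ A, degA H B a := by
  have h1 : ∀ b ∈ B, degB H A B b ≤ ∑ a ∈ A,
      (((B.powersetCard 2).filter fun p => insert a p ∈ H).filter fun p => b ∈ p).card := by
    intro b hb
    unfold degB
    rw [← Finset.card_sigma]
    refine Finset.card_le_card_of_injOn (fun q => ⟨q.2, {b, q.1}⟩) ?_ ?_
    · rintro ⟨x, a⟩ hq
      simp only [Finset.coe_filter, Finset.mem_product, Finset.mem_erase, Set.mem_ofPred_eq] at hq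
      simp only [Finset.coe_sigma, Set.mem_sigma_iff, Finset.mem_coe, Finset.mem_filter,
        Finset.mem_powersetCard]
      refine ⟨hq.1.2, ⟨⟨?_, Finset.card_pair (Ne.symm hq.1.1.1)⟩, ?_⟩, by simp⟩
      · intro y hy
        rcases Finset.mem_insert.1 hy with rfl | hy
        · exact hb
        · rw [Finset.mem_singleton.1 hy]; exact hq.1.1.2
      · convert hq.2 using 1
        ext y; simp only [Finset.mem_insert, Finset.mem_singleton]; tauto
    · rintro ⟨x, a⟩ hq ⟨y, c⟩ hq' h
      simp only [Finset.coe_filter, Finset.mem_product, Finset.mem_erase, Set.mem_ofPred_eq]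
        at hq hq'
      simp only [Sigma.mk.injEq, heq_eq_eq] at h
      obtain ⟨rfl, h⟩ := h
      have : x ∈ ({b, y} : Finset V) := h ▸ by simp
      simp only [Finset.mem_insert, Finset.mem_singleton] at this
      rw [this.resolve_left hq.1.1.1]
  refine (Finset.sum_le_sum h1).trans ?_
  rw [Finset.sum_comm, Finset.mul_sum]
  refine Finset.sum_le_sum fun a _ => ?_
  rw [sum_card_filter_mem]
  unfold degA
  rw [mul_comm, ← smul_eq_mul]
  refine Finset.sum_le_card_nsmul _ _ _ fun p hp => ?_
  rw [Finset.mem_filter, Finset.mem_powersetCard] at hp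
  rw [← hp.1.2]
  refine Finset.card_le_card fun x hx => ?_
  exact (Finset.mem_filter.1 hx).2

theorem card_add_one_le_of_missing {V : Type} [Fintype V] [DecidableEq V]
    {H : Finset (Finset V)} (hH : ∀ e ∈ H, e.card = 3) {m : ℕ} (hm : 0 < m)
    (hV : Fintype.card V = 3 * m)
    (hdeg : ∀ v : V, (3 * m - 1).choose 2 - (2 * m).choose 2 + 1 ≤
      (H.filter fun e => v ∈ e).card) {v : V} {P : Finset (Finset V)}
    (hP : ∀ p ∈ P, p.card = 2 ∧ v ∉ p ∧ insert v p ∉ H) :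
    P.card + 1 ≤ (2 * m).choose 2 := by
  have h1 : (H.filter fun e => v ∈ e).card + P.card ≤ (3 * m - 1).choose 2 := by
    have h2 : (H.filter fun e => v ∈ e).card = degA H (Finset.univ.erase v) v := by
      rw [degA_eq_card_filter hH (Finset.notMem_erase v _),
        Finset.insert_erase (Finset.mem_univ v)]
      simp
    have h3 : ((Finset.univ.erase v).powersetCard 2).card = (3 * m - 1).choose 2 := by
      rw [Finset.card_powersetCard, Finset.card_erase_of_mem (Finset.mem_univ v),
        Finset.card_univ, hV]
    rw [h2, ← h3, ← Finset.card_filter_add_card_filter_not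
      (s := (Finset.univ.erase v).powersetCard 2) (fun p => insert v p ∈ H)]
    refine Nat.add_le_add le_rfl (Finset.card_le_card fun p hp => ?_)
    obtain ⟨hc, hv, hn⟩ := hP p hp
    rw [Finset.mem_filter, Finset.mem_powersetCard]
    exact ⟨⟨fun x hx => Finset.mem_erase.2 ⟨fun h => hv (h ▸ hx), Finset.mem_univ x⟩, hc⟩, hn⟩
  have h2 := hdeg v
  have h3 : (2 * m).choose 2 ≤ (3 * m - 1).choose 2 := Nat.choose_le_choose 2 (by omega)
  omega

/-- The pairs `{x, y}` for `(x, y)` in a set `Q ⊆ X ×ˢ Y` with `X`, `Y` disjoint are distinct. -/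
theorem card_image_pair {V : Type} [DecidableEq V] {X Y : Finset V} (hXY : Disjoint X Y)
    {Q : Finset (V × V)} (hQ : Q ⊆ X ×ˢ Y) :
    (Q.image fun q => ({q.1, q.2} : Finset V)).card = Q.card := by
  refine Finset.card_image_of_injOn ?_
  rintro ⟨x, y⟩ h ⟨z, w⟩ h' he
  have hx := Finset.mem_product.1 (hQ h)
  have hz := Finset.mem_product.1 (hQ h')
  have h1 : x ∈ ({z, w} : Finset V) := by
    have : x ∈ ({x, y} : Finset V) := by simp
    simpa only [he] using this
  have h2 : y ∈ ({z, w} : Finset V) := by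
    have : y ∈ ({x, y} : Finset V) := by simp
    simpa only [he] using this
  simp only [Finset.mem_insert, Finset.mem_singleton] at h1 h2
  have h3 : x ≠ w := fun h => Finset.disjoint_left.1 hXY hx.1 (h ▸ hz.2)
  have h4 : y ≠ z := fun h => Finset.disjoint_left.1 hXY hz.1 (h ▸ hx.2)
  rw [h1.resolve_right h3, h2.resolve_left h4]

/-- Greedy matching covering a prescribed vertex set. -/
theorem exists_matching_covering {V : Type} [DecidableEq V] {H : Finset (Finset V)}
    (hH : ∀ e ∈ H, e.card = 3) (P : Finset V → Prop) {N : ℕ} (S : Finset V)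
    (h : ∀ v ∈ S, ∀ U : Finset V, U.card ≤ N → v ∉ U → ∃ e ∈ H, P e ∧ v ∈ e ∧ Disjoint e U)
    (W : Finset V) (hW : Disjoint S W) (hN : W.card + 4 * S.card ≤ N) :
    ∃ M ⊆ H, (M : Set (Finset V)).Pairwise (fun e f => Disjoint e f) ∧ M.card = S.card ∧
      (∀ e ∈ M, P e ∧ Disjoint e W) ∧ S ⊆ M.biUnion id := by
  induction S using Finset.induction_on generalizing W with
  | empty => exact ⟨∅, by simp⟩
  | insert v S hv ih =>
    rw [Finset.card_insert_of_notMem hv] at hN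
    rw [Finset.disjoint_insert_left] at hW
    obtain ⟨e, he, hPe, hve, hd⟩ := h v (Finset.mem_insert_self _ _) (W ∪ S)
      ((Finset.card_union_le _ _).trans (by omega))
      (by simp only [Finset.mem_union, not_or]; exact ⟨hW.1, hv⟩)
    rw [Finset.disjoint_union_right] at hd
    obtain ⟨M, hM, hpw, hc, hP, hcov⟩ := ih (fun w hw => h w (Finset.mem_insert_of_mem hw))
      (W ∪ e) (Finset.disjoint_union_right.2 ⟨hW.2, hd.2.symm⟩)
      (by have := Finset.card_union_le W e; rw [hH e he] at this; omega)
    have hne : ∀ f ∈ M, Disjoint e f := fun f hf =>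
      ((Finset.disjoint_union_right.1 (hP f hf).2).2).symm
    have heM : e ∉ M := fun hf => Finset.disjoint_left.1 (hne e hf) hve hve
    refine ⟨insert e M, Finset.insert_subset he hM, ?_, ?_, ?_, ?_⟩
    · rw [Finset.coe_insert]
      exact hpw.insert fun f hf _ => ⟨hne f hf, (hne f hf).symm⟩
    · rw [Finset.card_insert_of_notMem heM, hc, Finset.card_insert_of_notMem hv]
    · intro f hf
      rcases Finset.mem_insert.1 hf with rfl | hf
      · exact ⟨hPe, hd.1⟩
      · exact ⟨(hP f hf).1, (Finset.disjoint_union_right.1 (hP f hf).2).1⟩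
    · rw [Finset.biUnion_insert]
      refine Finset.insert_subset (Finset.mem_union_left _ hve) ?_
      exact hcov.trans Finset.subset_union_right

/-- Greedy matching of prescribed size. -/
theorem exists_matching_card {V : Type} [DecidableEq V] {H : Finset (Finset V)}
    (hH : ∀ e ∈ H, e.card = 3) (P : Finset V → Prop) {N : ℕ} (k : ℕ)
    (h : ∀ U : Finset V, U.card ≤ N → ∃ e ∈ H, P e ∧ Disjoint e U)
    (W : Finset V) (hN : W.card + 3 * k ≤ N + 3) :
    ∃ M ⊆ H, (M : Set (Finset V)).Pairwise (fun e f => Disjoint e f) ∧ M.card = k ∧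
      ∀ e ∈ M, P e ∧ Disjoint e W := by
  induction k generalizing W with
  | zero => exact ⟨∅, by simp⟩
  | succ k ih =>
    obtain ⟨e, he, hPe, hd⟩ := h W (by omega)
    obtain ⟨M, hM, hpw, hc, hP⟩ := ih (W ∪ e)
      (by have := Finset.card_union_le W e; rw [hH e he] at this; omega)
    have hne : ∀ f ∈ M, Disjoint e f := fun f hf =>
      ((Finset.disjoint_union_right.1 (hP f hf).2).2).symm
    have heM : e ∉ M := fun hf => by
      have h0 := hH e he
      rw [(Finset.disjoint_self_iff_empty e).1 (hne e hf)] at h0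
      simp at h0
    refine ⟨insert e M, Finset.insert_subset he hM, ?_, ?_, ?_⟩
    · rw [Finset.coe_insert]
      exact hpw.insert fun f hf _ => ⟨hne f hf, (hne f hf).symm⟩
    · rw [Finset.card_insert_of_notMem heM, hc]
    · intro f hf
      rcases Finset.mem_insert.1 hf with rfl | hf
      · exact ⟨hPe, hd⟩
      · exact ⟨(hP f hf).1, (Finset.disjoint_union_right.1 (hP f hf).2).1⟩

theorem choose_two_mul_two (m : ℕ) : (2 * m).choose 2 = m * (2 * m - 1) := by
  rw [Nat.choose_two_right, mul_assoc, Nat.mul_div_cancel_left _ two_pos]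

/-- The non-edges `{b, b', a}` at `b ∈ B`, as a family of pairs. -/
theorem exists_missing_pairs {V : Type} [DecidableEq V] (H : Finset (Finset V))
    {A B : Finset V} (hAB : Disjoint A B) {b : V} (hb : b ∈ B) :
    ∃ P : Finset (Finset V), P.card + degB H A B b = (B.card - 1) * A.card ∧
      ∀ p ∈ P, (p.card = 2 ∧ b ∉ p ∧ insert b p ∉ H) ∧ ¬ p ⊆ B := by
  have hd : Disjoint (B.erase b) A := (hAB.mono_right (Finset.erase_subset _ _)).symm
  refine ⟨(((B.erase b) ×ˢ A).filter fun q => ({b, q.1, q.2} : Finset V) ∉ H).image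
    fun q => {q.1, q.2}, ?_, ?_⟩
  · rw [card_image_pair hd (Finset.filter_subset _ _), ← Finset.card_erase_of_mem hb,
      ← Finset.card_product, degB, add_comm, Finset.card_filter_add_card_filter_not]
  · intro p hp
    obtain ⟨⟨x, a⟩, hq, rfl⟩ := Finset.mem_image.1 hp
    simp only [Finset.mem_filter, Finset.mem_product, Finset.mem_erase] at hq
    have haB : a ∉ B := Finset.disjoint_left.1 hAB hq.1.2
    refine ⟨⟨Finset.card_pair fun (h : x = a) => haB (h ▸ hq.1.1.2), ?_, hq.2⟩,
      fun h => haB (h (by simp))⟩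
    simp only [Finset.mem_insert, Finset.mem_singleton, not_or]
    exact ⟨hq.1.1.1.symm, fun h => haB (h ▸ hb)⟩

section MissingPairs

variable {V : Type} [DecidableEq V] {H : Finset (Finset V)} {m : ℕ} {A B : Finset V}

theorem card_missing_add_two_le
    (hK : ∀ (v : V) (P : Finset (Finset V)),
      (∀ p ∈ P, p.card = 2 ∧ v ∉ p ∧ insert v p ∉ H) → P.card + 1 ≤ (2 * m).choose 2)
    (hB : B.card = 2 * m) {b : V} (hb : b ∈ B) {P : Finset (Finset V)}
    (hP : ∀ p ∈ P, (p.card = 2 ∧ b ∉ p ∧ insert b p ∉ H) ∧ ¬ p ⊆ B) :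
    P.card + 2 ≤ 2 * m + degA H (B.erase b) b := by
  have hm : 0 < 2 * m := hB ▸ Finset.card_pos.2 ⟨b, hb⟩
  have h1 := hK b (P ∪ ((B.erase b).powersetCard 2).filter fun p => insert b p ∉ H) (by
    intro p hp
    rcases Finset.mem_union.1 hp with hp | hp
    · exact (hP p hp).1
    · rw [Finset.mem_filter, Finset.mem_powersetCard] at hp
      exact ⟨hp.1.2, fun h => Finset.notMem_erase b B (hp.1.1 h), hp.2⟩)
  rw [Finset.card_union_of_disjoint] at h1
  · have h2 := Finset.card_filter_add_card_filter_not
      (s := (B.erase b).powersetCard 2) (fun p => insert b p ∈ H)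
    rw [Finset.card_powersetCard, Finset.card_erase_of_mem hb, hB] at h2
    change degA H (B.erase b) b + _ = _ at h2
    obtain ⟨k, hk⟩ : ∃ k, 2 * m = k + 1 := ⟨2 * m - 1, by omega⟩
    have hcs : (k + 1).choose 2 = k + k.choose 2 := by
      rw [Nat.choose_succ_succ' k 1, Nat.choose_one_right]
    rw [hk] at h1 h2 ⊢
    simp only [Nat.add_sub_cancel] at h2
    omega
  · refine Finset.disjoint_left.2 fun p hp hp' => (hP p hp).2 ?_
    rw [Finset.mem_filter, Finset.mem_powersetCard] at hp'
    exact hp'.1.1.trans (Finset.erase_subset _ _)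

theorem choose_add_two_le_degB_add
    (hK : ∀ (v : V) (P : Finset (Finset V)),
      (∀ p ∈ P, p.card = 2 ∧ v ∉ p ∧ insert v p ∉ H) → P.card + 1 ≤ (2 * m).choose 2)
    (hAB : Disjoint A B) (hA : A.card = m) (hB : B.card = 2 * m) {b : V} (hb : b ∈ B) :
    (2 * m).choose 2 + 2 ≤ degB H A B b + 2 * m + degA H (B.erase b) b := by
  obtain ⟨P, hc, hP⟩ := exists_missing_pairs H hAB hb
  have := card_missing_add_two_le hK hB hb hP
  rw [hA, hB, mul_comm, ← choose_two_mul_two] at hc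
  omega

theorem two_mul_card_mul_choose_le
    (hH : ∀ e ∈ H, e.card = 3)
    (hK : ∀ (v : V) (P : Finset (Finset V)),
      (∀ p ∈ P, p.card = 2 ∧ v ∉ p ∧ insert v p ∉ H) → P.card + 1 ≤ (2 * m).choose 2)
    (hAB : Disjoint A B) (hA : A.card = m) (hB : B.card = 2 * m) {S : Finset V} (hS : S ⊆ A) :
    2 * S.card * (2 * m).choose 2 + 4 * m ≤
      2 * ∑ a ∈ S, degA H B a + 4 * m * m + 3 * (H.filter fun e => e ⊆ B).card := by
  have h1 := Finset.sum_le_sum fun b hb => choose_add_two_le_degB_add hK hAB hA hB (b := b) hb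
  simp only [Finset.sum_add_distrib, sum_degA_erase hH, Finset.sum_const, hB,
    smul_eq_mul] at h1
  have h2 := sum_degB_le H A B
  have h3 : ∑ a ∈ A, degA H B a ≤
      (m - S.card) * (2 * m).choose 2 + ∑ a ∈ S, degA H B a := by
    rw [← Finset.sum_sdiff hS, ← hA, ← Finset.card_sdiff_of_subset hS, ← smul_eq_mul]
    refine Nat.add_le_add (Finset.sum_le_card_nsmul _ _ _ fun a _ => ?_) le_rfl
    exact (degA_le_choose H B a).trans_eq (by rw [hB, hA])
  obtain ⟨k, hk⟩ := Nat.exists_eq_add_of_le (hA ▸ Finset.card_le_card hS)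
  rw [show m - S.card = k by omega] at h3
  generalize (2 * m).choose 2 = T at *
  have h4 : 2 * m * T = 2 * S.card * T + 2 * (k * T) := by rw [hk]; ring
  linarith

/-- A triple with two vertices in `A` and one in `B`. -/
theorem inter_card_of_triple (hAB : Disjoint A B) {x y b : V} (hx : x ∈ A) (hy : y ∈ A)
    (hxy : x ≠ y) (hb : b ∈ B) :
    (({x, y, b} : Finset V) ∩ A).card = 2 ∧ (({x, y, b} : Finset V) ∩ B).card = 1 := by
  have hxB := Finset.disjoint_left.1 hAB hx
  have hyB := Finset.disjoint_left.1 hAB hy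
  have hbA := Finset.disjoint_right.1 hAB hb
  rw [Finset.insert_inter_of_mem hx, Finset.insert_inter_of_mem hy,
    Finset.singleton_inter_of_notMem hbA, Finset.insert_inter_of_notMem hxB,
    Finset.insert_inter_of_notMem hyB, Finset.singleton_inter_of_mem hb]
  exact ⟨Finset.card_pair hxy, Finset.card_singleton b⟩

theorem exists_edge_AAB_through
    (hK : ∀ (v : V) (P : Finset (Finset V)),
      (∀ p ∈ P, p.card = 2 ∧ v ∉ p ∧ insert v p ∉ H) → P.card + 1 ≤ (2 * m).choose 2)
    (hAB : Disjoint A B) (hB : B.card = 2 * m) {a : V} (ha : a ∈ A) {U : Finset V} (haU : a ∉ U)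
    (hdeg : degA H B a ≤ ((A \ U).card - 1) * (B \ U).card) :
    ∃ e ∈ H, ((e ∩ A).card = 2 ∧ (e ∩ B).card = 1) ∧ a ∈ e ∧ Disjoint e U := by
  by_contra! hcon
  have haB := Finset.disjoint_left.1 hAB ha
  have hd : Disjoint ((A \ U).erase a) (B \ U) :=
    hAB.mono ((Finset.erase_subset _ _).trans Finset.sdiff_subset) Finset.sdiff_subset
  have h1 := hK a (((B.powersetCard 2).filter fun p => insert a p ∉ H) ∪
    (((A \ U).erase a) ×ˢ (B \ U)).image fun q => {q.1, q.2}) (by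
    intro p hp
    rcases Finset.mem_union.1 hp with hp | hp
    · rw [Finset.mem_filter, Finset.mem_powersetCard] at hp
      exact ⟨hp.1.2, fun h => haB (hp.1.1 h), hp.2⟩
    · obtain ⟨⟨x, y⟩, hq, rfl⟩ := Finset.mem_image.1 hp
      simp only [Finset.mem_product, Finset.mem_erase, Finset.mem_sdiff] at hq
      obtain ⟨⟨hxa, hxA, hxU⟩, hyB, hyU⟩ := hq
      refine ⟨Finset.card_pair fun (h : x = y) => Finset.disjoint_left.1 hAB hxA (h ▸ hyB), ?_,
        fun h => ?_⟩
      · simp only [Finset.mem_insert, Finset.mem_singleton, not_or]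
        exact ⟨hxa.symm, fun h => haB (h ▸ hyB)⟩
      · refine hcon _ h (inter_card_of_triple hAB ha hxA hxa.symm hyB) (by simp) ?_
        simp only [Finset.disjoint_insert_left, Finset.disjoint_singleton_left]
        exact ⟨haU, hxU, hyU⟩)
  rw [Finset.card_union_of_disjoint, card_image_pair hd subset_rfl, Finset.card_product,
    Finset.card_erase_of_mem (Finset.mem_sdiff.2 ⟨ha, haU⟩)] at h1
  · have h2 := Finset.card_filter_add_card_filter_not
      (s := B.powersetCard 2) (fun p => insert a p ∈ H)
    rw [Finset.card_powersetCard, hB] at h2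
    change degA H B a + _ = _ at h2
    omega
  · refine Finset.disjoint_left.2 fun p hp hp' => ?_
    obtain ⟨⟨x, y⟩, hq, rfl⟩ := Finset.mem_image.1 hp'
    rw [Finset.mem_filter, Finset.mem_powersetCard] at hp
    simp only [Finset.mem_product, Finset.mem_erase, Finset.mem_sdiff] at hq
    exact Finset.disjoint_left.1 hAB hq.1.2.1 (hp.1.1 (by simp))

theorem exists_edge_BBB_through
    (hK : ∀ (v : V) (P : Finset (Finset V)),
      (∀ p ∈ P, p.card = 2 ∧ v ∉ p ∧ insert v p ∉ H) → P.card + 1 ≤ (2 * m).choose 2)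
    (hAB : Disjoint A B) (hA : A.card = m) (hB : B.card = 2 * m) {b : V} (hb : b ∈ B)
    {U : Finset V} (hbU : b ∉ U) (hdeg : degB H A B b ≤ ((B \ U).card - 1).choose 2) :
    ∃ e ∈ H, e ⊆ B ∧ b ∈ e ∧ Disjoint e U := by
  by_contra! hcon
  obtain ⟨P, hc, hP⟩ := exists_missing_pairs H hAB hb
  have h1 := hK b (P ∪ ((B \ U).erase b).powersetCard 2) (by
    intro p hp
    rcases Finset.mem_union.1 hp with hp | hp
    · exact (hP p hp).1
    · rw [Finset.mem_powersetCard] at hp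
      refine ⟨hp.2, fun h => Finset.notMem_erase b _ (hp.1 h), fun h => ?_⟩
      have hpU := hp.1.trans (Finset.erase_subset _ _)
      refine hcon _ h (Finset.insert_subset hb (hpU.trans Finset.sdiff_subset)) (by simp) ?_
      rw [Finset.disjoint_insert_left]
      exact ⟨hbU, Finset.disjoint_of_subset_left hpU Finset.sdiff_disjoint⟩)
  rw [hA, hB, mul_comm, ← choose_two_mul_two] at hc
  rw [Finset.card_union_of_disjoint, Finset.card_powersetCard,
    Finset.card_erase_of_mem (Finset.mem_sdiff.2 ⟨hb, hbU⟩)] at h1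
  · omega
  · refine Finset.disjoint_left.2 fun p hp hp' => (hP p hp).2 ?_
    rw [Finset.mem_powersetCard] at hp'
    exact (hp'.1.trans (Finset.erase_subset _ _)).trans Finset.sdiff_subset

theorem exists_edge_AAB_avoiding
    (hK : ∀ (v : V) (P : Finset (Finset V)),
      (∀ p ∈ P, p.card = 2 ∧ v ∉ p ∧ insert v p ∉ H) → P.card + 1 ≤ (2 * m).choose 2)
    (hAB : Disjoint A B) (hB : B.card = 2 * m) {b : V} (hb : b ∈ B) {U : Finset V} (hbU : b ∉ U)
    (hdeg : 2 * m + degA H (B.erase b) b < (A \ U).card.choose 2 + 2) :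
    ∃ e ∈ H, ((e ∩ A).card = 2 ∧ (e ∩ B).card = 1) ∧ Disjoint e U := by
  by_contra! hcon
  have h1 := card_missing_add_two_le hK hB hb (P := (A \ U).powersetCard 2) (by
    intro p hp
    rw [Finset.mem_powersetCard] at hp
    have hpA := hp.1.trans Finset.sdiff_subset
    obtain ⟨x, y, hxy, rfl⟩ := Finset.card_eq_two.1 hp.2
    have hx := hpA (Finset.mem_insert_self x _)
    have hy := hpA (Finset.mem_insert_of_mem (Finset.mem_singleton_self y))
    have hbp : b ∉ ({x, y} : Finset V) := fun h => Finset.disjoint_left.1 hAB (hpA h) hb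
    refine ⟨⟨hp.2, hbp, fun h => ?_⟩,
      fun h => Finset.disjoint_left.1 hAB hx (h (Finset.mem_insert_self x _))⟩
    have he : insert b {x, y} = ({x, y, b} : Finset V) := by
      ext z; simp only [Finset.mem_insert, Finset.mem_singleton]; tauto
    refine hcon _ h ?_ ?_
    · rw [he]; exact inter_card_of_triple hAB hx hy hxy hb
    · rw [Finset.disjoint_insert_left]
      exact ⟨hbU, Finset.disjoint_of_subset_left hp.1 Finset.sdiff_disjoint⟩)
  rw [Finset.card_powersetCard] at h1
  omega

end MissingPairs

theorem exists_edge_BBB_avoiding {V : Type} [DecidableEq V] {H : Finset (Finset V)}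
    (hH : ∀ e ∈ H, e.card = 3) {B U : Finset V} {D : ℕ}
    (hD : ∀ b ∈ B, degA H (B.erase b) b ≤ D)
    (hU : U.card * D < (H.filter fun e => e ⊆ B).card) :
    ∃ e ∈ H, e ⊆ B ∧ Disjoint e U := by
  by_contra! hcon
  refine hU.not_ge ?_
  have h1 : (H.filter fun e => e ⊆ B) ⊆
      (U ∩ B).biUnion fun b => H.filter fun e => e ⊆ insert b (B.erase b) ∧ b ∈ e := by
    intro e he
    rw [Finset.mem_filter] at he
    obtain ⟨b, hbe, hbU⟩ := Finset.not_disjoint_iff.1 (hcon e he.1 he.2)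
    refine Finset.mem_biUnion.2 ⟨b, Finset.mem_inter.2 ⟨hbU, he.2 hbe⟩, ?_⟩
    rw [Finset.mem_filter, Finset.insert_erase (he.2 hbe)]
    exact ⟨he.1, he.2, hbe⟩
  refine (Finset.card_le_card h1).trans ((Finset.card_biUnion_le_card_mul _ _ D ?_).trans
    (Nat.mul_le_mul_right _ (Finset.card_le_card Finset.inter_subset_left)))
  intro b hb
  rw [← degA_eq_card_filter hH (Finset.notMem_erase b B)]
  exact hD b (Finset.mem_inter.1 hb).2

theorem card_biUnion_inter {V : Type} [DecidableEq V] {M : Finset (Finset V)}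
    (hM : (M : Set (Finset V)).Pairwise (fun e f => Disjoint e f)) (C : Finset V) {j : ℕ}
    (hj : ∀ e ∈ M, (e ∩ C).card = j) : (M.biUnion id ∩ C).card = M.card * j := by
  rw [Finset.biUnion_inter, Finset.card_biUnion, ← smul_eq_mul]
  · exact Finset.sum_eq_card_nsmul hj
  · exact fun e he f hf hne =>
      (hM he hf hne).mono Finset.inter_subset_left Finset.inter_subset_left

/-- Equally many `BBB`-edges and `AAB`-edges cover twice as many vertices of `B` as of `A`. -/
theorem balanced_union {V : Type} [DecidableEq V] {H M M' : Finset (Finset V)}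
    (hH : ∀ e ∈ H, e.card = 3) {A B : Finset V} (hAB : Disjoint A B)
    (hM : M ⊆ H) (hM' : M' ⊆ H) (hc : M.card = M'.card)
    (hpw : (M : Set (Finset V)).Pairwise (fun e f => Disjoint e f))
    (hpw' : (M' : Set (Finset V)).Pairwise (fun e f => Disjoint e f))
    (hB : ∀ e ∈ M, e ⊆ B)
    (hAAB : ∀ e ∈ M', ((e ∩ A).card = 2 ∧ (e ∩ B).card = 1) ∧ Disjoint e (M.biUnion id)) :
    M ∪ M' ⊆ H ∧ ((M ∪ M' : Finset (Finset V)) : Set (Finset V)).Pairwise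
      (fun e f => Disjoint e f) ∧
    ((M ∪ M').biUnion id ∩ B).card = 2 * ((M ∪ M').biUnion id ∩ A).card := by
  have hd : Disjoint (M.biUnion id) (M'.biUnion id) := by
    rw [Finset.disjoint_biUnion_right]
    exact fun e he => (hAAB e he).2.symm
  refine ⟨Finset.union_subset hM hM', ?_, ?_⟩
  · rw [Finset.coe_union]
    refine Set.pairwise_union.2 ⟨hpw, hpw', fun e he f hf _ => ?_⟩
    have : Disjoint e f := hd.mono (Finset.subset_biUnion_of_mem id he)
      (Finset.subset_biUnion_of_mem id hf)
    exact ⟨this, this.symm⟩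
  · have hcount : ∀ C : Finset V, ((M ∪ M').biUnion id ∩ C).card =
        (M.biUnion id ∩ C).card + (M'.biUnion id ∩ C).card := fun C => by
      rw [Finset.union_biUnion, Finset.union_inter_distrib_right, Finset.card_union_of_disjoint
        (hd.mono Finset.inter_subset_left Finset.inter_subset_left)]
    rw [hcount, hcount,
      card_biUnion_inter hpw B (j := 3) fun e he => by
        rw [Finset.inter_eq_left.2 (hB e he), hH e (hM he)],
      card_biUnion_inter hpw A (j := 0) fun e he => by
        rw [Finset.card_eq_zero, ← Finset.disjoint_iff_inter_eq_empty]
        exact (hAB.mono_right (hB e he)).symm,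
      card_biUnion_inter hpw' B fun e he => (hAAB e he).1.2,
      card_biUnion_inter hpw' A fun e he => (hAAB e he).1.1]
    omega

theorem card_biUnion_of_matching {V : Type} [DecidableEq V] {H M : Finset (Finset V)}
    (hH : ∀ e ∈ H, e.card = 3) (hM : M ⊆ H) : (M.biUnion id).card ≤ M.card * 3 :=
  Finset.card_biUnion_le_card_mul _ _ _ fun e he => (hH e (hM he)).le

theorem cast_choose_two_mul_two (m : ℕ) : ((2 * m).choose 2 : ℝ) = m * (2 * m - 1) := by
  rw [Nat.cast_choose_two]
  push_cast
  ring

section Exceptional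

variable {V : Type} [DecidableEq V] {H : Finset (Finset V)} {m : ℕ} {A B : Finset V} {γ : ℝ}

/-- If some vertex of `A` is exceptional then a matching balances and covers all of them. -/
theorem exists_matching_of_exceptional_A
    (hH : ∀ e ∈ H, e.card = 3) (hm : 1000 ≤ m)
    (hK : ∀ (v : V) (P : Finset (Finset V)),
      (∀ p ∈ P, p.card = 2 ∧ v ∉ p ∧ insert v p ∉ H) → P.card + 1 ≤ (2 * m).choose 2)
    (hAB : Disjoint A B) (hA : A.card = m) (hB : B.card = 2 * m)
    (hγ : 0 < γ) (hγ' : γ < 1 / 100)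
    (hE : ((H.filter fun e => e ⊆ B).card : ℝ) ≤ 1 / 100000 * (m : ℝ) ^ 3)
    {S : Finset V} (hS : S ⊆ A) (hne : S.Nonempty)
    (hSdeg : ∀ a ∈ S, (degA H B a : ℝ) < γ * ((2 * m).choose 2 : ℝ))
    (hmin : ∀ a ∈ A, ∀ b ∈ B, degA H (B.erase b) b ≤ degA H B a) :
    ∃ M ⊆ H, (M : Set (Finset V)).Pairwise (fun e f => Disjoint e f) ∧ S ⊆ M.biUnion id ∧
      (M.biUnion id ∩ B).card = 2 * (M.biUnion id ∩ A).card := by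
  obtain ⟨a₀, ha₀⟩ := hne
  have hmR : (1000 : ℝ) ≤ m := by exact_mod_cast hm
  have hF := two_mul_card_mul_choose_le hH hK hAB hA hB hS
  have hs1 : 1 ≤ S.card := Finset.card_pos.2 ⟨a₀, ha₀⟩
  by_cases hone : S.card = 1 ∧ 1 ≤ degA H B a₀
  · obtain ⟨p, hp⟩ := Finset.card_pos.1 hone.2
    rw [Finset.mem_filter, Finset.mem_powersetCard] at hp
    have haB := Finset.disjoint_left.1 hAB (hS ha₀)
    refine ⟨{insert a₀ p}, by simpa using hp.2, by simp, ?_, ?_⟩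
    · obtain ⟨x, hx⟩ := Finset.card_eq_one.1 hone.1
      have : a₀ = x := by rw [hx] at ha₀; exact Finset.mem_singleton.1 ha₀
      rw [hx, ← this]
      simp
    · rw [Finset.singleton_biUnion, id, Finset.insert_inter_of_notMem haB,
        Finset.insert_inter_of_mem (hS ha₀), Finset.inter_eq_left.2 hp.1.1,
        Finset.disjoint_iff_inter_eq_empty.1 (Finset.disjoint_of_subset_left hp.1.1 hAB.symm),
        hp.1.2]
      simp
  have hT := cast_choose_two_mul_two m
  have hFR : 2 * (S.card : ℝ) * ((2 * m).choose 2 : ℝ) + 4 * m ≤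
      2 * ∑ a ∈ S, (degA H B a : ℝ) + 4 * m * m + 3 * ((H.filter fun e => e ⊆ B).card : ℝ) := by
    exact_mod_cast hF
  have hsum : ∑ a ∈ S, (degA H B a : ℝ) ≤ S.card * (γ * ((2 * m).choose 2 : ℝ)) := by
    rw [← nsmul_eq_mul]
    exact Finset.sum_le_card_nsmul _ _ _ fun a ha => (hSdeg a ha).le
  set s : ℕ := S.card with hs
  set E : ℕ := (H.filter fun e => e ⊆ B).card with hEdef
  set T : ℝ := ((2 * m).choose 2 : ℝ) with hTdef
  have hs1R : (1 : ℝ) ≤ s := by exact_mod_cast hs1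
  have hTlow : 199 / 100 * (m : ℝ) ^ 2 ≤ T := by rw [hT]; nlinarith
  have hThigh : T ≤ 2 * (m : ℝ) ^ 2 := by rw [hT]; nlinarith
  have hTpos : 0 < T := by nlinarith
  have hγs : (s : ℝ) * (γ * T) ≤ s * T / 100 := by
    have : γ * T ≤ T / 100 := by nlinarith
    nlinarith
  have hsmall : 100 * s ≤ m := by
    have h1 : (s : ℝ) * (394 / 100) * (m : ℝ) ^ 2 ≤ (4 + 3 / 100000 * m) * (m : ℝ) ^ 2 := by
      have h2 : (s : ℝ) * (199 / 100 * (m : ℝ) ^ 2) ≤ s * T :=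
        mul_le_mul_of_nonneg_left hTlow (by linarith)
      have h3 : (0 : ℝ) ≤ s * (m : ℝ) ^ 2 := by positivity
      nlinarith
    have h2 := le_of_mul_le_mul_right h1 (by positivity)
    have h3 : (100 * s : ℝ) ≤ m := by linarith
    exact_mod_cast h3
  obtain ⟨M, hM, hpw, hc, hMB⟩ := exists_matching_card hH (fun e => e ⊆ B) (N := 3 * (s - 1)) s
    (fun U hU => exists_edge_BBB_avoiding hH (fun b hb => hmin a₀ (hS ha₀) b hb) (by
      change U.card * degA H B a₀ < E
      have hD := hSdeg a₀ ha₀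
      rcases hs1.eq_or_lt with h1 | h2
      · have hz : degA H B a₀ = 0 := by
          by_contra h
          exact hone ⟨h1.symm, Nat.one_le_iff_ne_zero.2 h⟩
        obtain ⟨x, hx⟩ := Finset.card_eq_one.1 h1.symm
        have hax : a₀ = x := by rw [hx] at ha₀; exact Finset.mem_singleton.1 ha₀
        rw [hz, mul_zero]
        rw [hx, Finset.sum_singleton, ← hax, hz, ← h1, hT] at hFR
        have : (0 : ℝ) < E := by push_cast at hFR; nlinarith
        exact_mod_cast this
      · have hs2 : (2 : ℝ) ≤ s := by exact_mod_cast h2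
        have hUR : (U.card : ℝ) ≤ 3 * (s - 1) := by
          have : (U.card : ℝ) ≤ ((3 * (s - 1) : ℕ) : ℝ) := by exact_mod_cast hU
          rwa [Nat.cast_mul, Nat.cast_sub hs1, Nat.cast_ofNat, Nat.cast_one] at this
        have h3 : (U.card : ℝ) * degA H B a₀ ≤ 3 * (s - 1) * (γ * T) :=
          mul_le_mul hUR hD.le (by positivity) (by linarith)
        have h4 : 3 * ((s : ℝ) - 1) * (γ * T) ≤ 3 * (s - 1) * (T / 100) :=
          mul_le_mul_of_nonneg_left (by nlinarith) (by linarith)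
        have h5 : (2 : ℝ) * T ≤ s * T := mul_le_mul_of_nonneg_right hs2 hTpos.le
        have h6 : 4 * (m : ℝ) * m = 2 * T + 2 * m := by rw [hT]; ring
        have : (U.card : ℝ) * degA H B a₀ < E := by linarith
        exact_mod_cast this))
    ∅ (by rw [Finset.card_empty]; omega)
  have hMS : Disjoint S (M.biUnion id) := by
    rw [Finset.disjoint_biUnion_right]
    exact fun e he => Finset.disjoint_of_subset_left hS
      (Finset.disjoint_of_subset_right (hMB e he).1 hAB)
  obtain ⟨M', hM', hpw', hc', hAAB, hcov⟩ := exists_matching_covering hH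
    (fun e => (e ∩ A).card = 2 ∧ (e ∩ B).card = 1) (N := m / 2) S
    (fun a ha U hU haU => exists_edge_AAB_through hK hAB hB (hS ha) haU (by
      have h1 : (m / 3 : ℕ) ≤ (A \ U).card - 1 := by
        have := Finset.le_card_sdiff U A; omega
      have h2 : m ≤ (B \ U).card := by
        have := Finset.le_card_sdiff U B; omega
      refine le_trans ?_ (Nat.mul_le_mul h1 h2)
      have h3 : (m : ℝ) ≤ 3 * ((m / 3 : ℕ) : ℝ) + 3 := by
        have : m ≤ 3 * (m / 3) + 3 := by omega
        exact_mod_cast this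
      have h4 := hSdeg a ha
      have h5 : (degA H B a : ℝ) ≤ ((m / 3 : ℕ) : ℝ) * m := by
        nlinarith
      exact_mod_cast h5))
    (M.biUnion id) hMS (by
      have := card_biUnion_of_matching hH hM
      rw [hc] at this
      omega)
  obtain ⟨h1, h2, h3⟩ := balanced_union hH hAB hM hM' (hc.trans hc'.symm) hpw hpw'
    (fun e he => (hMB e he).1) hAAB
  refine ⟨M ∪ M', h1, h2, hcov.trans ?_, h3⟩
  rw [Finset.union_biUnion]
  exact Finset.subset_union_right

/-- The exceptional vertices of `B` are covered by a balancing matching. -/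
theorem exists_matching_of_exceptional_B
    (hH : ∀ e ∈ H, e.card = 3) (hm : 1000 ≤ m)
    (hK : ∀ (v : V) (P : Finset (Finset V)),
      (∀ p ∈ P, p.card = 2 ∧ v ∉ p ∧ insert v p ∉ H) → P.card + 1 ≤ (2 * m).choose 2)
    (hAB : Disjoint A B) (hA : A.card = m) (hB : B.card = 2 * m)
    (hγ' : γ < 1 / 100)
    (hE : ((H.filter fun e => e ⊆ B).card : ℝ) ≤ 1 / 100000 * (m : ℝ) ^ 3)
    {S : Finset V} (hS : S ⊆ B)
    (hSdeg : ∀ b ∈ S, (degB H A B b : ℝ) < γ * ((2 * m).choose 2 : ℝ)) :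
    ∃ M ⊆ H, (M : Set (Finset V)).Pairwise (fun e f => Disjoint e f) ∧ S ⊆ M.biUnion id ∧
      (M.biUnion id ∩ B).card = 2 * (M.biUnion id ∩ A).card := by
  have hmR : (1000 : ℝ) ≤ m := by exact_mod_cast hm
  have hT := cast_choose_two_mul_two m
  have hsum : ∑ b ∈ B, (degA H (B.erase b) b : ℝ) =
      3 * ((H.filter fun e => e ⊆ B).card : ℝ) := by
    exact_mod_cast sum_degA_erase hH B
  have hF := fun b hb => choose_add_two_le_degB_add hK hAB hA hB (b := b) hb
  set E : ℕ := (H.filter fun e => e ⊆ B).card with hEdef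
  set T : ℝ := ((2 * m).choose 2 : ℝ) with hTdef
  have hTlow : 199 / 100 * (m : ℝ) ^ 2 ≤ T := by rw [hT]; nlinarith
  have hThigh : T ≤ 2 * (m : ℝ) ^ 2 := by rw [hT]; nlinarith
  have hγT : γ * T ≤ T / 100 := by nlinarith
  have hsub : ∀ X ⊆ B, ∀ c : ℝ, (∀ b ∈ X, c ≤ (degA H (B.erase b) b : ℝ)) →
      X.card * c ≤ 3 / 100000 * (m : ℝ) ^ 3 := by
    intro X hX c h
    have h1 : X.card * c ≤ ∑ b ∈ X, (degA H (B.erase b) b : ℝ) := by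
      rw [← nsmul_eq_mul]
      exact Finset.card_nsmul_le_sum _ _ _ h
    have h2 : ∑ b ∈ X, (degA H (B.erase b) b : ℝ) ≤ ∑ b ∈ B, (degA H (B.erase b) b : ℝ) :=
      Finset.sum_le_sum_of_subset_of_nonneg hX fun _ _ _ => Nat.cast_nonneg _
    linarith
  have hsmall : 100 * S.card ≤ m := by
    have h1 := hsub S hS ((m : ℝ) ^ 2) fun b hb => by
      have h2 : ((2 * m).choose 2 : ℝ) + 2 ≤
          degB H A B b + 2 * m + degA H (B.erase b) b := by
        exact_mod_cast hF b (hS hb)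
      have h3 := hSdeg b hb
      nlinarith
    have h2 : (S.card : ℝ) * (m : ℝ) ^ 2 ≤ (3 / 100000 * m) * (m : ℝ) ^ 2 := by linarith
    have h3 := le_of_mul_le_mul_right h2 (by positivity)
    have h4 : (100 * S.card : ℝ) ≤ m := by linarith
    exact_mod_cast h4
  obtain ⟨M, hM, hpw, hc, hMB, hcov⟩ := exists_matching_covering hH (fun e => e ⊆ B)
    (N := m / 2) S
    (fun b hb U hU hbU => exists_edge_BBB_through hK hAB hA hB (hS hb) hbU (by
      have h1 : m ≤ (B \ U).card - 1 := by
        have := Finset.le_card_sdiff U B; omega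
      refine le_trans ?_ (Nat.choose_le_choose 2 h1)
      have h2 := hSdeg b hb
      have h3 : (degB H A B b : ℝ) ≤ (m.choose 2 : ℝ) := by
        rw [Nat.cast_choose_two]; nlinarith
      exact_mod_cast h3))
    ∅ (Finset.disjoint_empty_right _) (by rw [Finset.card_empty]; omega)
  obtain ⟨M', hM', hpw', hc', hAAB⟩ := exists_matching_card hH
    (fun e => (e ∩ A).card = 2 ∧ (e ∩ B).card = 1) (N := m / 2) S.card
    (fun U hU => by
      by_contra hcon
      have hA' : m / 2 ≤ (A \ U).card := by
        have := Finset.le_card_sdiff U A; omega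
      have hB' : m ≤ (B \ U).card := by
        have := Finset.le_card_sdiff U B; omega
      have h1 := hsub (B \ U) Finset.sdiff_subset ((m : ℝ) ^ 2 / 10) fun b hb => by
        rw [Finset.mem_sdiff] at hb
        have h2 : (m / 2).choose 2 + 2 ≤ 2 * m + degA H (B.erase b) b := by
          by_contra! h
          exact hcon (exists_edge_AAB_avoiding hK hAB hB hb.1 hb.2
            (h.trans_le (Nat.add_le_add_right (Nat.choose_le_choose 2 hA') 2)))
        have h3 : ((m / 2).choose 2 : ℝ) + 2 ≤ 2 * m + degA H (B.erase b) b := by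
          exact_mod_cast h2
        rw [Nat.cast_choose_two] at h3
        have h4 : (m : ℝ) ≤ 2 * ((m / 2 : ℕ) : ℝ) + 1 := by
          have : m ≤ 2 * (m / 2) + 1 := by omega
          exact_mod_cast this
        nlinarith
      have h2 : (m : ℝ) * ((m : ℝ) ^ 2 / 10) ≤ (B \ U).card * ((m : ℝ) ^ 2 / 10) :=
        mul_le_mul_of_nonneg_right (by exact_mod_cast hB') (by positivity)
      have h3 : (0 : ℝ) < (m : ℝ) ^ 3 := by positivity
      linarith)
    (M.biUnion id) (by
      have := card_biUnion_of_matching hH hM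
      rw [hc] at this
      omega)
  obtain ⟨h1, h2, h3⟩ := balanced_union hH hAB hM hM' (hc.trans hc'.symm) hpw hpw'
    (fun e he => (hMB e he).1) hAAB
  refine ⟨M ∪ M', h1, h2, hcov.trans ?_, h3⟩
  rw [Finset.union_biUnion]
  exact Finset.subset_union_left

/-- A vertex of `B` with few `BBB`-edges is not exceptional. -/
theorem le_degB_of_degA_erase_lt (hm : 1000 ≤ m)
    (hK : ∀ (v : V) (P : Finset (Finset V)),
      (∀ p ∈ P, p.card = 2 ∧ v ∉ p ∧ insert v p ∉ H) → P.card + 1 ≤ (2 * m).choose 2)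
    (hAB : Disjoint A B) (hA : A.card = m) (hB : B.card = 2 * m) (hγ' : γ < 1 / 100)
    {b : V} (hb : b ∈ B) (hdeg : (degA H (B.erase b) b : ℝ) < γ * ((2 * m).choose 2 : ℝ)) :
    γ * ((2 * m).choose 2 : ℝ) ≤ degB H A B b := by
  have hmR : (1000 : ℝ) ≤ m := by exact_mod_cast hm
  have h1 : ((2 * m).choose 2 : ℝ) + 2 ≤ degB H A B b + 2 * m + degA H (B.erase b) b := by
    exact_mod_cast choose_add_two_le_degB_add hK hAB hA hB hb
  have hT : 199 / 100 * (m : ℝ) ^ 2 ≤ ((2 * m).choose 2 : ℝ) := by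
    rw [cast_choose_two_mul_two]; nlinarith
  have h2 : γ * ((2 * m).choose 2 : ℝ) ≤ ((2 * m).choose 2 : ℝ) / 100 := by nlinarith
  nlinarith

end Exceptional

/-- Among all sets of the size of `B₀`, one spanning the fewest edges has every vertex of its
complement of degree at least that of any of its own vertices. -/
theorem exists_minimal_part {V : Type} [Fintype V] [DecidableEq V] {H : Finset (Finset V)}
    (hH : ∀ e ∈ H, e.card = 3) (B₀ : Finset V) :
    ∃ B : Finset V, B.card = B₀.card ∧
      (H.filter fun e => e ⊆ B).card ≤ (H.filter fun e => e ⊆ B₀).card ∧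
      ∀ a ∈ Bᶜ, ∀ b ∈ B, degA H (B.erase b) b ≤ degA H B a := by
  obtain ⟨B, hB, hmin⟩ := Finset.exists_min_image (Finset.univ.powersetCard B₀.card)
    (fun B : Finset V => (H.filter fun e => e ⊆ B).card)
    ⟨B₀, Finset.mem_powersetCard.2 ⟨Finset.subset_univ _, rfl⟩⟩
  rw [Finset.mem_powersetCard] at hB
  refine ⟨B, hB.2, hmin B₀ (Finset.mem_powersetCard.2 ⟨Finset.subset_univ _, rfl⟩), ?_⟩
  intro a ha b hb
  have haB : a ∉ B.erase b := fun h => Finset.mem_compl.1 ha (Finset.mem_of_mem_erase h)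
  have h1 := hmin (insert a (B.erase b)) (Finset.mem_powersetCard.2 ⟨Finset.subset_univ _, by
    rw [Finset.card_insert_of_notMem haB, Finset.card_erase_add_one hb, hB.2]⟩)
  rw [card_filter_subset_insert hH haB] at h1
  have h2 := card_filter_subset_insert hH (Finset.notMem_erase b B)
  rw [Finset.insert_erase hb] at h2
  have h3 := degA_mono H (Finset.erase_subset b B) a
  omega

/-- Claim: given an extremal partition, there is a (possibly shifted) partition
`V = Ā ∪ B̄` with the same parameters and a matching `M` covering all strongly
exceptional vertices `S_Ā ∪ S_B̄`, such that
`|B̄ ∖ V(M)| = 2·|Ā ∖ V(M)| = (2/3)·(n − |V(M)|)`. -/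
theorem stmt18 :
    ∃ α₀ : ℝ, 0 < α₀ ∧ ∃ n₀ : ℕ, ∀ α : ℝ, 0 < α → α < α₀ → ∀ n : ℕ, n₀ ≤ n → 3 ∣ n →
    ∀ (V : Type) [Fintype V] [DecidableEq V], Fintype.card V = n →
    ∀ H : Finset (Finset V), (∀ e ∈ H, e.card = 3) →
    (∀ v : V, (n - 1).choose 2 - (2 * n / 3).choose 2 + 1 ≤ (H.filter fun e => v ∈ e).card) →
    (∃ A B : Finset V, Disjoint A B ∧ A ∪ B = Finset.univ ∧
      A.card = n / 3 ∧ B.card = 2 * n / 3 ∧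
      ((H.filter fun e => e ⊆ B).card : ℝ) < 6 * α * ((2 * n / 3).choose 3 : ℝ)) →
    ∃ A B : Finset V, Disjoint A B ∧ A ∪ B = Finset.univ ∧
      A.card = n / 3 ∧ B.card = 2 * n / 3 ∧
      ((H.filter fun e => e ⊆ B).card : ℝ) < 6 * α * ((2 * n / 3).choose 3 : ℝ) ∧
      ∃ M : Finset (Finset V), M ⊆ H ∧
        (M : Set (Finset V)).Pairwise (fun e f => Disjoint e f) ∧
        (∀ a ∈ A, (degA H B a : ℝ) < α ^ ((1 : ℝ) / 3) * ((2 * n / 3).choose 2 : ℝ) →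
          a ∈ M.biUnion id) ∧
        (∀ b ∈ B, (degB H A B b : ℝ) <
            α ^ ((1 : ℝ) / 3) * ((n / 3 : ℕ) : ℝ) * (((2 * n / 3 : ℕ) : ℝ) - 1) →
          b ∈ M.biUnion id) ∧
        (B \ M.biUnion id).card = 2 * (A \ M.biUnion id).card ∧
        3 * (B \ M.biUnion id).card = 2 * (n - (M.biUnion id).card) := by
  refine ⟨1 / 1000000, by norm_num, 3000, ?_⟩
  intro α hα hα' n hn h3n V _ _ hV H hH hdeg ⟨A₀, B₀, _, _, _, hB₀, hE₀⟩
  obtain ⟨m, rfl⟩ := h3n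
  have hm : 1000 ≤ m := by omega
  have hdiv : 3 * m / 3 = m := by omega
  have hdiv' : 2 * (3 * m) / 3 = 2 * m := by omega
  simp only [hdiv, hdiv'] at hB₀ hE₀ hdeg ⊢
  obtain ⟨B, hBc, hEle, hmin⟩ := exists_minimal_part hH B₀
  have hB : B.card = 2 * m := hBc.trans hB₀
  have hA : Bᶜ.card = m := by rw [Finset.card_compl, hV, hB]; omega
  have hAB : Disjoint Bᶜ B := disjoint_compl_left
  have hun : Bᶜ ∪ B = Finset.univ := by rw [Finset.union_comm, Finset.union_compl]
  have hE : ((H.filter fun e => e ⊆ B).card : ℝ) < 6 * α * ((2 * m).choose 3 : ℝ) :=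
    lt_of_le_of_lt (by exact_mod_cast hEle) hE₀
  refine ⟨Bᶜ, B, hAB, hun, hA, hB, hE, ?_⟩
  have hK : ∀ (v : V) (P : Finset (Finset V)),
      (∀ p ∈ P, p.card = 2 ∧ v ∉ p ∧ insert v p ∉ H) → P.card + 1 ≤ (2 * m).choose 2 :=
    fun v P hP => card_add_one_le_of_missing hH (by omega) hV hdeg hP
  have hγ : 0 < α ^ ((1 : ℝ) / 3) := Real.rpow_pos_of_pos hα _
  have hγ' : α ^ ((1 : ℝ) / 3) < 1 / 100 := by
    have h1 : α ^ ((1 : ℝ) / 3) < (1 / 1000000 : ℝ) ^ ((1 : ℝ) / 3) :=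
      Real.rpow_lt_rpow hα.le hα' (by norm_num)
    have h2 : (1 / 1000000 : ℝ) = (1 / 100) ^ (3 : ℝ) := by norm_num
    rwa [h2, ← Real.rpow_mul (by norm_num), mul_one_div_cancel (by norm_num),
      Real.rpow_one] at h1
  generalize α ^ ((1 : ℝ) / 3) = γ at hγ hγ' ⊢
  have hE' : ((H.filter fun e => e ⊆ B).card : ℝ) ≤ 1 / 100000 * (m : ℝ) ^ 3 := by
    have h1 : ((2 * m).choose 3 : ℝ) ≤ (2 * m : ℝ) ^ 3 / 6 := by
      have := Nat.choose_le_pow_div (α := ℝ) 3 (2 * m)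
      norm_num [Nat.factorial] at this ⊢
      exact this
    have h2 : 6 * α * ((2 * m).choose 3 : ℝ) ≤ 6 * α * ((2 * m : ℝ) ^ 3 / 6) :=
      mul_le_mul_of_nonneg_left h1 (by linarith)
    have h3 : α * (m : ℝ) ^ 3 ≤ 1 / 1000000 * (m : ℝ) ^ 3 :=
      mul_le_mul_of_nonneg_right hα'.le (by positivity)
    nlinarith
  have hthr : γ * (m : ℝ) * (((2 * m : ℕ) : ℝ) - 1) = γ * ((2 * m).choose 2 : ℝ) := by
    rw [cast_choose_two_mul_two]; push_cast; ring
  rw [hthr]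
  have key : ∃ M ⊆ H, (M : Set (Finset V)).Pairwise (fun e f => Disjoint e f) ∧
      (∀ a ∈ Bᶜ, (degA H B a : ℝ) < γ * ((2 * m).choose 2 : ℝ) → a ∈ M.biUnion id) ∧
      (∀ b ∈ B, (degB H Bᶜ B b : ℝ) < γ * ((2 * m).choose 2 : ℝ) → b ∈ M.biUnion id) ∧
      (M.biUnion id ∩ B).card = 2 * (M.biUnion id ∩ Bᶜ).card := by
    rcases (Bᶜ.filter fun a => (degA H B a : ℝ) < γ * ((2 * m).choose 2 : ℝ)).eq_empty_or_nonempty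
      with hemp | hne
    · obtain ⟨M, hM, hpw, hcov, hbal⟩ := exists_matching_of_exceptional_B hH hm hK hAB hA hB hγ'
        hE' (Finset.filter_subset
          (fun b => (degB H Bᶜ B b : ℝ) < γ * ((2 * m).choose 2 : ℝ)) B)
        fun b hb => (Finset.mem_filter.1 hb).2
      refine ⟨M, hM, hpw, fun a ha h => ?_, fun b hb h => hcov (Finset.mem_filter.2 ⟨hb, h⟩), hbal⟩
      exact absurd (Finset.mem_filter.2 ⟨ha, h⟩) (hemp ▸ Finset.notMem_empty a)
    · obtain ⟨M, hM, hpw, hcov, hbal⟩ := exists_matching_of_exceptional_A hH hm hK hAB hA hB hγ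
        hγ' hE' (Finset.filter_subset _ _) hne (fun a ha => (Finset.mem_filter.1 ha).2) hmin
      refine ⟨M, hM, hpw, fun a ha h => hcov (Finset.mem_filter.2 ⟨ha, h⟩), fun b hb h => ?_, hbal⟩
      obtain ⟨a, ha⟩ := hne
      rw [Finset.mem_filter] at ha
      have h1 : (degA H (B.erase b) b : ℝ) ≤ degA H B a := by exact_mod_cast hmin a ha.1 b hb
      exact absurd h (le_degB_of_degA_erase_lt hm hK hAB hA hB hγ' hb (h1.trans_lt ha.2)).not_gt
  obtain ⟨M, hM, hpw, hcA, hcB, hbal⟩ := key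
  refine ⟨M, hM, hpw, hcA, hcB, ?_⟩
  have h1 := Finset.card_sdiff_add_card_inter B (M.biUnion id)
  have h2 := Finset.card_sdiff_add_card_inter Bᶜ (M.biUnion id)
  have h3 : (M.biUnion id).card = (M.biUnion id ∩ Bᶜ).card + (M.biUnion id ∩ B).card := by
    rw [← Finset.card_union_of_disjoint (hAB.mono Finset.inter_subset_right
      Finset.inter_subset_right), ← Finset.inter_union_distrib_left, hun, Finset.inter_univ]
  rw [Finset.inter_comm] at h1 h2
  omega
end
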